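/- Let μ be a positive odd integer and let ν > 0 be real with μ − ν ∉ 2ℤ. Then for every j ∈ ℕ₀ the four functions Λ_{1,j}^{μ,ν}, Λ_{2,j}^{μ,ν}, Λ_{3,j}^{μ,ν}, Λ_{4,j}^{μ,ν} on (0,∞) are linearly independent; since each of them solves the fourth-order equation D_{μ,ν}u = 4j(j+μ+1)u on (0,∞), they form a fundamental system of solutions of this equation. -/

import Mathlib

noncomputable section

open Set MeasureTheory Filter Topology

/-- The Euler operator `θ = x·d/dx` acting on real-valued functions on `ℝ`. -/
def eulerOp (u : ℝ → ℝ) : ℝ → ℝ := fun x => x * deriv u x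

/-- The operator `(θ + a)(θ + b) − x²` applied to `v`. -/
def quadOp (a b : ℝ) (v : ℝ → ℝ) : ℝ → ℝ := fun x =>
  eulerOp (fun y => eulerOp v y + b * v y) x
    + a * (eulerOp v x + b * v x) - x ^ 2 * v x

/-- The fourth-order operator `D_{μ,ν} = x⁻²((θ+μ+ν)(θ+μ) − x²)(θ(θ+ν) − x²)`. -/
def Dop (μ ν : ℝ) (u : ℝ → ℝ) : ℝ → ℝ := fun x =>
  quadOp (μ + ν) μ (quadOp 0 ν u) x / x ^ 2

/-- The normalized I-Bessel function `Ĩ_α(z) = Σ (z/2)^{2n}/(n!·Γ(n+α+1))`. -/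
def tildeI (α z : ℝ) : ℝ :=
  ∑' n : ℕ, (z / 2) ^ (2 * n) / ((n.factorial : ℝ) * Real.Gamma ((n : ℝ) + α + 1))

/-- The K-Bessel function `K_α(z) = ∫₀^∞ e^{−z·cosh s}·cosh(α·s) ds`. -/
def besselK (α z : ℝ) : ℝ :=
  ∫ s in Ioi (0 : ℝ), Real.exp (-z * Real.cosh s) * Real.cosh (α * s)

/-- The normalized K-Bessel function `K̃_α(z) = (z/2)^{−α}·K_α(z)`. -/
def tildeK (α z : ℝ) : ℝ := (z / 2) ^ (-α) * besselK α z

/-- The generating function `G₁^{μ,ν}(t,x)`. -/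
def genG₁ (μ ν t x : ℝ) : ℝ :=
  (1 - t) ^ (-(μ + ν + 2) / 2) * tildeI (μ / 2) (t * x / (1 - t)) * tildeI (ν / 2) (x / (1 - t))

/-- The generating function `G₂^{μ,ν}(t,x)`. -/
def genG₂ (μ ν t x : ℝ) : ℝ :=
  (1 - t) ^ (-(μ + ν + 2) / 2) * tildeI (μ / 2) (t * x / (1 - t)) * tildeK (ν / 2) (x / (1 - t))

/-- The generating function `G₃^{μ,ν}(t,x)`. -/
def genG₃ (μ ν t x : ℝ) : ℝ :=
  (1 - t) ^ (-(μ + ν + 2) / 2) * tildeK (μ / 2) (t * x / (1 - t)) * tildeI (ν / 2) (x / (1 - t))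

/-- The generating function `G₄^{μ,ν}(t,x)`. -/
def genG₄ (μ ν t x : ℝ) : ℝ :=
  (1 - t) ^ (-(μ + ν + 2) / 2) * tildeK (μ / 2) (t * x / (1 - t)) * tildeK (ν / 2) (x / (1 - t))

/-- `Λ₁ⱼ^{μ,ν}(x) = (1/j!)·(∂/∂t)^j|₀ G₁^{μ,ν}(t,x)`. -/
def Lambda₁ (μ ν : ℝ) (j : ℕ) (x : ℝ) : ℝ :=
  iteratedDeriv j (fun t => genG₁ μ ν t x) 0 / (j.factorial : ℝ)

/-- `Λ₂ⱼ^{μ,ν}(x) = (1/j!)·(∂/∂t)^j|₀ G₂^{μ,ν}(t,x)`. -/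
def Lambda₂ (μ ν : ℝ) (j : ℕ) (x : ℝ) : ℝ :=
  iteratedDeriv j (fun t => genG₂ μ ν t x) 0 / (j.factorial : ℝ)

/-- `Λ₁ⱼ` for integer `j`, vanishing for `j < 0`. -/
def Lambda₁Z (μ ν : ℝ) (j : ℤ) (x : ℝ) : ℝ :=
  if 0 ≤ j then Lambda₁ μ ν j.toNat x else 0

/-- `Λ₂ⱼ` for integer `j`, vanishing for `j < 0`. -/
def Lambda₂Z (μ ν : ℝ) (j : ℤ) (x : ℝ) : ℝ :=
  if 0 ≤ j then Lambda₂ μ ν j.toNat x else 0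

/-- For `μ = m` a positive odd integer, `Λ₃ⱼ^{μ,ν}(x) = (1/(j+μ)!)·(∂/∂t)^{j+μ}|₀ [tᵐ·G₃]`,
the derivative at `0` being the limit from the right of the `(j+μ)`-th derivative of the
real-analytic function `t ↦ tᵐ·G₃^{m,ν}(t,x)` on `(0,1)`; it vanishes for `j < −μ`. -/
def Lambda₃ (m : ℕ) (ν : ℝ) (j : ℤ) (x : ℝ) : ℝ :=
  if -(m : ℤ) ≤ j then
    limUnder (𝓝[>] (0 : ℝ))
        (fun t => iteratedDeriv (j + (m : ℤ)).toNat (fun s => s ^ m * genG₃ (m : ℝ) ν s x) t) /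
      (((j + (m : ℤ)).toNat.factorial : ℝ))
  else 0

/-- For `μ = m` a positive odd integer, `Λ₄ⱼ^{μ,ν}(x) = (1/(j+μ)!)·(∂/∂t)^{j+μ}|₀ [tᵐ·G₄]`,
vanishing for `j < −μ`. -/
def Lambda₄ (m : ℕ) (ν : ℝ) (j : ℤ) (x : ℝ) : ℝ :=
  if -(m : ℤ) ≤ j then
    limUnder (𝓝[>] (0 : ℝ))
        (fun t => iteratedDeriv (j + (m : ℤ)).toNat (fun s => s ^ m * genG₄ (m : ℝ) ν s x) t) /
      (((j + (m : ℤ)).toNat.factorial : ℝ))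
  else 0

open scoped ContDiff

/-! ### The K-Bessel function -/

theorem Real.cosh_le_exp_abs (x : ℝ) : Real.cosh x ≤ Real.exp |x| := by
  rw [← Real.cosh_abs, Real.cosh_eq]
  have : Real.exp (-|x|) ≤ Real.exp |x| := Real.exp_le_exp.2 (by linarith [abs_nonneg x])
  linarith

theorem Real.abs_sinh_le_exp_abs (x : ℝ) : |Real.sinh x| ≤ Real.exp |x| := by
  rw [Real.abs_sinh, Real.sinh_eq]
  have := Real.exp_pos (-|x|)
  have := Real.exp_pos |x|
  linarith

theorem exp_mul_exp_neg_mul_cosh_le {w z s : ℝ} (hw : 0 < w) (hz : w ≤ z) (hs : 0 ≤ s) (c : ℝ) :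
    Real.exp (c * s) * Real.exp (-z * Real.cosh s)
      ≤ Real.exp ((c + 1) ^ 2 / w) * Real.exp (-s) := by
  rw [← Real.exp_add, ← Real.exp_add, Real.exp_le_exp]
  have h1 : s ^ 2 / 4 ≤ Real.cosh s := by
    rw [Real.cosh_eq]
    have := Real.quadratic_le_exp_of_nonneg hs
    have := Real.exp_pos (-s)
    linarith
  have h2 : w * (s ^ 2 / 4) ≤ z * Real.cosh s :=
    mul_le_mul hz h1 (by positivity) (by linarith)
  have h3 : (c + 1) ^ 2 / w - (c + 1) * s + w * (s ^ 2 / 4) = ((c + 1) - w * s / 2) ^ 2 / w := by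
    field_simp
    ring
  have h4 : 0 ≤ ((c + 1) - w * s / 2) ^ 2 / w := by positivity
  nlinarith

/-- A continuous function of at most exponential growth times `e^{-z cosh s}` is integrable. -/
theorem integrableOn_mul_exp_neg_mul_cosh {f : ℝ → ℝ} (hf : Continuous f) {c z : ℝ} (hz : 0 < z)
    (hb : ∀ s, 0 ≤ s → |f s| ≤ Real.exp (c * s)) :
    IntegrableOn (fun s => f s * Real.exp (-z * Real.cosh s)) (Ioi 0) := by
  have hg : IntegrableOn (fun s : ℝ => Real.exp ((c + 1) ^ 2 / z) * Real.exp (-s)) (Ioi 0) :=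
    (integrableOn_exp_neg_Ioi 0).const_mul _
  refine Integrable.mono' hg ?_ ?_
  · exact Continuous.aestronglyMeasurable (by fun_prop)
  · refine (ae_restrict_iff' measurableSet_Ioi).2 (Eventually.of_forall fun s hs => ?_)
    have hs : 0 ≤ s := le_of_lt hs
    rw [Real.norm_eq_abs, abs_mul, Real.abs_exp]
    exact (mul_le_mul_of_nonneg_right (hb s hs) (Real.exp_pos _).le).trans
      (exp_mul_exp_neg_mul_cosh_le hz le_rfl hs c)

theorem abs_cosh_mul_le {α s : ℝ} (hs : 0 ≤ s) :
    |Real.cosh (α * s)| ≤ Real.exp (|α| * s) := by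
  rw [abs_of_pos (Real.cosh_pos _)]
  simpa [abs_mul, abs_of_nonneg hs] using Real.cosh_le_exp_abs (α * s)

theorem abs_sinh_mul_le {α s : ℝ} (hs : 0 ≤ s) :
    |Real.sinh (α * s)| ≤ Real.exp (|α| * s) := by
  simpa [abs_mul, abs_of_nonneg hs] using Real.abs_sinh_le_exp_abs (α * s)

theorem integrableOn_besselK (α : ℝ) {z : ℝ} (hz : 0 < z) :
    IntegrableOn (fun s => Real.exp (-z * Real.cosh s) * Real.cosh (α * s)) (Ioi 0) := by
  simpa only [mul_comm] using integrableOn_mul_exp_neg_mul_cosh (f := fun s => Real.cosh (α * s))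
    (c := |α|) (by fun_prop) hz fun s hs => abs_cosh_mul_le hs

theorem besselK_neg (α z : ℝ) : besselK (-α) z = besselK α z := by
  simp [besselK]

theorem besselK_pos (α : ℝ) {z : ℝ} (hz : 0 < z) : 0 < besselK α z := by
  rw [besselK, setIntegral_pos_iff_support_of_nonneg_ae]
  · have : Function.support (fun s => Real.exp (-z * Real.cosh s) * Real.cosh (α * s)) = univ := by
      ext s
      simp [(Real.cosh_pos (α * s)).ne']
    rw [this, univ_inter, Real.volume_Ioi]
    exact ENNReal.zero_lt_top
  · exact Eventually.of_forall fun s =>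
      mul_nonneg (Real.exp_pos _).le (Real.cosh_pos _).le
  · exact integrableOn_besselK α hz

theorem hasDerivAt_besselK_integral (α : ℝ) {z : ℝ} (hz : 0 < z) :
    HasDerivAt (besselK α)
      (∫ s in Ioi (0 : ℝ), -(Real.cosh s * Real.cosh (α * s) * Real.exp (-z * Real.cosh s))) z := by
  have key := hasDerivAt_integral_of_dominated_loc_of_deriv_le
    (μ := volume.restrict (Ioi (0 : ℝ))) (x₀ := z) (s := Ioi (z / 2))
    (F := fun z s => Real.exp (-z * Real.cosh s) * Real.cosh (α * s))
    (F' := fun z s => -(Real.cosh s * Real.cosh (α * s) * Real.exp (-z * Real.cosh s)))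
    (bound := fun s => Real.exp ((1 + |α| + 1) ^ 2 / (z / 2)) * Real.exp (-s))
    (Ioi_mem_nhds (by linarith))
    (Eventually.of_forall fun w => Continuous.aestronglyMeasurable (by fun_prop))
    (integrableOn_besselK α hz)
    (Continuous.aestronglyMeasurable (by fun_prop))
    ?_ ((integrableOn_exp_neg_Ioi 0).const_mul _) ?_
  · exact key.2
  · refine (ae_restrict_iff' measurableSet_Ioi).2 (Eventually.of_forall fun s hs w hw => ?_)
    have hs : 0 ≤ s := le_of_lt hs
    rw [norm_neg, Real.norm_eq_abs, abs_mul, abs_mul, Real.abs_exp]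
    refine le_trans (mul_le_mul_of_nonneg_right ?_ (Real.exp_pos _).le)
      (exp_mul_exp_neg_mul_cosh_le (by linarith) (le_of_lt hw) hs (1 + |α|))
    rw [add_mul, Real.exp_add]
    have h1 := abs_cosh_mul_le (α := 1) hs
    rw [abs_one, one_mul] at h1
    exact mul_le_mul (by simpa using h1) (abs_cosh_mul_le hs) (abs_nonneg _) (Real.exp_pos _).le
  · refine Eventually.of_forall fun s w _ => ?_
    have h := (((hasDerivAt_id w).neg.mul_const (Real.cosh s)).exp).mul_const (Real.cosh (α * s))
    refine h.congr_deriv ?_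
    simp
    ring

theorem besselK_integration_by_parts (α : ℝ) {z : ℝ} (hz : 0 < z) :
    IntegrableOn (fun s => Real.sinh s * Real.sinh (α * s) * Real.exp (-z * Real.cosh s)) (Ioi 0) ∧
    z * ∫ s in Ioi (0 : ℝ), Real.sinh s * Real.sinh (α * s) * Real.exp (-z * Real.cosh s)
      = α * besselK α z := by
  have hint : IntegrableOn
      (fun s => Real.sinh s * Real.sinh (α * s) * Real.exp (-z * Real.cosh s)) (Ioi 0) := by
    refine integrableOn_mul_exp_neg_mul_cosh (c := 1 + |α|) (by fun_prop) hz fun s hs => ?_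
    rw [abs_mul, add_mul, Real.exp_add]
    have h1 := abs_sinh_mul_le (α := 1) hs
    rw [abs_one, one_mul] at h1
    exact mul_le_mul (by simpa using h1) (abs_sinh_mul_le hs) (abs_nonneg _) (Real.exp_pos _).le
  refine ⟨hint, ?_⟩
  have hK := (integrableOn_besselK α hz).const_mul α
  have hS := hint.const_mul z
  have h := integral_Ioi_of_hasDerivAt_of_tendsto' (a := (0 : ℝ)) (m := 0)
    (f := fun s => Real.sinh (α * s) * Real.exp (-z * Real.cosh s))
    (f' := fun s => α * (Real.exp (-z * Real.cosh s) * Real.cosh (α * s))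
      - z * (Real.sinh s * Real.sinh (α * s) * Real.exp (-z * Real.cosh s)))
    (fun s _ => ?_) (hK.sub hS) ?_
  · rw [integral_sub hK hS, integral_const_mul, integral_const_mul] at h
    simp only [mul_zero, Real.sinh_zero, zero_mul, sub_zero] at h
    rw [besselK]
    linarith
  · have h := (((hasDerivAt_id s).const_mul α).sinh).mul
      (((Real.hasDerivAt_cosh s).const_mul (-z)).exp)
    refine h.congr_deriv ?_
    simp
    ring
  · refine squeeze_zero_norm' (a := fun s => Real.exp ((|α| + 1) ^ 2 / z) * Real.exp (-s)) ?_ ?_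
    · filter_upwards [eventually_ge_atTop (0 : ℝ)] with s hs
      rw [Real.norm_eq_abs, abs_mul, Real.abs_exp]
      exact (mul_le_mul_of_nonneg_right (abs_sinh_mul_le hs) (Real.exp_pos _).le).trans
        (exp_mul_exp_neg_mul_cosh_le hz le_rfl hs _)
    · simpa using (Real.tendsto_exp_neg_atTop_nhds_zero).const_mul _

theorem hasDerivAt_besselK (α : ℝ) {z : ℝ} (hz : 0 < z) :
    HasDerivAt (besselK α) (-besselK (α - 1) z - α / z * besselK α z) z := by
  refine (hasDerivAt_besselK_integral α hz).congr_deriv ?_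
  obtain ⟨hint, hparts⟩ := besselK_integration_by_parts α hz
  have h : ∀ s, -(Real.cosh s * Real.cosh (α * s) * Real.exp (-z * Real.cosh s))
      = -(Real.exp (-z * Real.cosh s) * Real.cosh ((α - 1) * s))
        - Real.sinh s * Real.sinh (α * s) * Real.exp (-z * Real.cosh s) := by
    intro s
    rw [sub_mul, one_mul, Real.cosh_sub]
    ring
  simp_rw [h]
  rw [integral_sub (f := fun s => -(Real.exp (-z * Real.cosh s) * Real.cosh ((α - 1) * s)))
    (integrableOn_besselK _ hz).neg hint, integral_neg, ← besselK]
  have : α / z * besselK α z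
      = ∫ s in Ioi (0 : ℝ), Real.sinh s * Real.sinh (α * s) * Real.exp (-z * Real.cosh s) := by
    rw [div_mul_eq_mul_div, ← hparts, mul_div_cancel_left₀ _ hz.ne']
  rw [this]

theorem hasDerivAt_besselK' (α : ℝ) {z : ℝ} (hz : 0 < z) :
    HasDerivAt (besselK α) (-besselK (α + 1) z + α / z * besselK α z) z := by
  have h := hasDerivAt_besselK (-α) hz
  have e : besselK (-α) = besselK α := funext (besselK_neg α)
  rw [e, show -α - 1 = -(α + 1) by ring, besselK_neg] at h
  refine h.congr_deriv ?_
  ring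

theorem hasDerivAt_tildeK (α : ℝ) {z : ℝ} (hz : 0 < z) :
    HasDerivAt (tildeK α) (-(z / 2) * tildeK (α + 1) z) z := by
  have h1 : HasDerivAt (fun y : ℝ => (y / 2) ^ (-α)) (1 / 2 * -α * (z / 2) ^ (-α - 1)) z :=
    ((hasDerivAt_id z).div_const 2).rpow_const (Or.inl (by simp; positivity))
  refine (h1.mul (hasDerivAt_besselK' α hz)).congr_deriv ?_
  have hz2 : 0 < z / 2 := by positivity
  rw [tildeK, show -(α + 1) = -α - 1 by ring, Real.rpow_sub_one hz2.ne']
  field_simp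
  ring

theorem hasDerivAt_tildeK_succ (α : ℝ) {z : ℝ} (hz : 0 < z) :
    HasDerivAt (tildeK (α + 1)) (-(2 / z) * tildeK α z - 2 * (α + 1) / z * tildeK (α + 1) z) z := by
  have h1 : HasDerivAt (fun y : ℝ => (y / 2) ^ (-(α + 1)))
      (1 / 2 * -(α + 1) * (z / 2) ^ (-(α + 1) - 1)) z :=
    ((hasDerivAt_id z).div_const 2).rpow_const (Or.inl (by simp; positivity))
  refine (h1.mul (hasDerivAt_besselK (α + 1) hz)).congr_deriv ?_
  have hz2 : 0 < z / 2 := by positivity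
  rw [tildeK, tildeK, Real.rpow_sub_one hz2.ne', show -(α + 1) = -α - 1 by ring,
    Real.rpow_sub_one hz2.ne', add_sub_cancel_right]
  field_simp
  ring

theorem contDiffOn_tildeK (α : ℝ) : ContDiffOn ℝ ∞ (tildeK α) (Ioi 0) := by
  refine contDiffOn_infty.2 fun n => ?_
  induction n generalizing α with
  | zero =>
    exact contDiffOn_zero.2 fun z hz => (hasDerivAt_tildeK α hz).continuousAt.continuousWithinAt
  | succ n ih =>
    rw [Nat.cast_add, Nat.cast_one, contDiffOn_succ_iff_deriv_of_isOpen isOpen_Ioi]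
    refine ⟨fun z hz => (hasDerivAt_tildeK α hz).differentiableAt.differentiableWithinAt,
      by simp, ?_⟩
    refine ContDiffOn.congr (f := fun z => -(z / 2) * tildeK (α + 1) z) ?_
      fun z hz => (hasDerivAt_tildeK α hz).deriv
    exact ContDiffOn.mul (by fun_prop) (ih _)

/-! ### The I-Bessel function -/

theorem factorial_mul_Gamma_le {α : ℝ} (hα : 0 ≤ α) (n : ℕ) :
    (n.factorial : ℝ) * Real.Gamma (α + 1) ≤ Real.Gamma (n + α + 1) := by
  induction n with
  | zero => simp
  | succ n ih =>
    have h : (0 : ℝ) < n + α + 1 := by positivity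
    rw [show ((n + 1 : ℕ) : ℝ) + α + 1 = (n + α + 1) + 1 by push_cast; ring,
      Real.Gamma_add_one h.ne', Nat.factorial_succ, Nat.cast_mul, mul_assoc]
    refine mul_le_mul ?_ ih ?_ h.le
    · push_cast; linarith
    · exact mul_nonneg (Nat.cast_nonneg _) (Real.Gamma_pos_of_pos (by linarith)).le

/-- The coefficients of `Ĩ_α` as a power series in `(z/2)²`. -/
def besselCoeff (α : ℝ) (n : ℕ) : ℝ := ((n.factorial : ℝ) * Real.Gamma (n + α + 1))⁻¹

theorem besselCoeff_nonneg {α : ℝ} (hα : 0 ≤ α) (n : ℕ) : 0 ≤ besselCoeff α n :=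
  inv_nonneg.2 (mul_nonneg (Nat.cast_nonneg _) (Real.Gamma_pos_of_pos (by positivity)).le)

theorem besselCoeff_le {α : ℝ} (hα : 0 ≤ α) (n : ℕ) :
    besselCoeff α n ≤ (Real.Gamma (α + 1))⁻¹ / n.factorial := by
  have hΓ : 0 < Real.Gamma (α + 1) := Real.Gamma_pos_of_pos (by positivity)
  have h1 : (1 : ℝ) ≤ n.factorial := by exact_mod_cast Nat.one_le_iff_ne_zero.2 n.factorial_ne_zero
  have h2 := factorial_mul_Gamma_le hα n
  rw [besselCoeff, div_eq_inv_mul, ← mul_inv]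
  refine inv_anti₀ (by positivity) (mul_le_mul_of_nonneg_left ?_ (by positivity))
  nlinarith

theorem besselCoeff_succ {α : ℝ} (n : ℕ) :
    (n + 1) * besselCoeff α (n + 1) = besselCoeff (α + 1) n := by
  rw [besselCoeff, besselCoeff, Nat.factorial_succ,
    show ((n + 1 : ℕ) : ℝ) + α + 1 = n + (α + 1) + 1 by push_cast; ring]
  have : (n + 1 : ℝ) ≠ 0 := by positivity
  push_cast
  rw [mul_assoc, mul_inv, mul_inv_cancel_left₀ this]

theorem besselCoeff_add_one {α : ℝ} (hα : 0 ≤ α) (n : ℕ) :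
    (n + α + 1) * besselCoeff (α + 1) n = besselCoeff α n := by
  have h : (n + α + 1 : ℝ) ≠ 0 := by positivity
  rw [besselCoeff, besselCoeff, ← add_assoc, Real.Gamma_add_one h]
  rw [mul_left_comm, mul_inv, mul_inv_cancel_left₀ h]

theorem summable_besselCoeff {α : ℝ} (hα : 0 ≤ α) (q : ℝ) :
    Summable fun n => besselCoeff α n * q ^ n := by
  refine Summable.of_norm_bounded
    ((Real.summable_pow_div_factorial |q|).mul_left (Real.Gamma (α + 1))⁻¹) fun n => ?_
  rw [norm_mul, norm_pow, Real.norm_eq_abs, Real.norm_eq_abs,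
    abs_of_nonneg (besselCoeff_nonneg hα n)]
  refine (mul_le_mul_of_nonneg_right (besselCoeff_le hα n) (by positivity)).trans_eq (by ring)

/-- `Ĩ_α` as a function of `q = (z/2)²`. -/
def besselSeries (α q : ℝ) : ℝ := ∑' n, besselCoeff α n * q ^ n

theorem tildeI_eq (α z : ℝ) : tildeI α z = besselSeries α ((z / 2) ^ 2) := by
  simp only [tildeI, besselSeries, besselCoeff, ← pow_mul]
  exact tsum_congr fun n => div_eq_inv_mul _ _

theorem hasDerivAt_besselSeries {α : ℝ} (hα : 0 ≤ α) (q : ℝ) :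
    HasDerivAt (besselSeries α) (besselSeries (α + 1) q) q := by
  set r := |q| + 1 with hr
  have hsum : Summable fun n : ℕ => besselCoeff α n * (n * r ^ (n - 1)) := by
    rw [← summable_nat_add_iff 1]
    refine (summable_besselCoeff (by positivity : 0 ≤ α + 1) r).congr fun n => ?_
    rw [← besselCoeff_succ]
    simp only [Nat.add_sub_cancel]
    push_cast
    ring
  have h := hasDerivAt_tsum_of_isPreconnected (t := Metric.ball (0 : ℝ) r)
    (g := fun n y => besselCoeff α n * y ^ n)
    (g' := fun n y => besselCoeff α n * (n * y ^ (n - 1))) hsum Metric.isOpen_ball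
    (convex_ball 0 r).isPreconnected (fun n y _ => (hasDerivAt_pow n y).const_mul _)
    (fun n y hy => ?_) (y₀ := q) (y := q) (by simp [hr]) (summable_besselCoeff hα q) (by simp [hr])
  · refine h.congr_deriv ?_
    have hq : Summable fun n : ℕ => besselCoeff α n * (n * q ^ (n - 1)) := by
      rw [← summable_nat_add_iff 1]
      refine (summable_besselCoeff (by positivity : 0 ≤ α + 1) q).congr fun n => ?_
      rw [← besselCoeff_succ]
      simp only [Nat.add_sub_cancel]
      push_cast
      ring
    rw [hq.tsum_eq_zero_add, besselSeries]
    simp only [Nat.cast_zero, zero_mul, mul_zero, zero_add]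
    refine tsum_congr fun n => ?_
    rw [← besselCoeff_succ]
    simp only [Nat.add_sub_cancel]
    push_cast
    ring
  · rw [norm_mul, norm_mul, norm_pow, Real.norm_eq_abs, Real.norm_natCast,
      abs_of_nonneg (besselCoeff_nonneg hα n)]
    have hy' : ‖y‖ ≤ r := by simpa using (Metric.mem_ball.1 hy).le
    have := besselCoeff_nonneg hα n
    gcongr

theorem contDiff_besselSeries {α : ℝ} (hα : 0 ≤ α) : ContDiff ℝ ∞ (besselSeries α) := by
  refine contDiff_infty.2 fun n => ?_
  induction n generalizing α with
  | zero =>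
    exact contDiff_zero.2
      (continuous_iff_continuousAt.2 fun q => (hasDerivAt_besselSeries hα q).continuousAt)
  | succ n ih =>
    rw [Nat.cast_add, Nat.cast_one, contDiff_succ_iff_deriv]
    refine ⟨fun q => (hasDerivAt_besselSeries hα q).differentiableAt, by simp, ?_⟩
    rw [show deriv (besselSeries α) = besselSeries (α + 1) from
      funext fun q => (hasDerivAt_besselSeries hα q).deriv]
    exact ih (by positivity)

theorem besselSeries_recurrence {α : ℝ} (hα : 0 ≤ α) (q : ℝ) :
    q * besselSeries (α + 2) q + (α + 1) * besselSeries (α + 1) q = besselSeries α q := by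
  have h1 := summable_besselCoeff (by positivity : 0 ≤ α + 1) q
  have h2 := summable_besselCoeff (by positivity : 0 ≤ α + 2) q
  have h3 : Summable fun n : ℕ => (n : ℝ) * besselCoeff (α + 1) n * q ^ n := by
    rw [← summable_nat_add_iff 1]
    refine (h2.mul_left q).congr fun n => ?_
    rw [show α + 2 = (α + 1) + 1 by ring, ← besselCoeff_succ]
    push_cast
    ring
  have h4 : q * besselSeries (α + 2) q = ∑' n : ℕ, (n : ℝ) * besselCoeff (α + 1) n * q ^ n := by
    rw [h3.tsum_eq_zero_add, besselSeries, ← tsum_mul_left]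
    simp only [Nat.cast_zero, zero_mul, zero_add]
    refine tsum_congr fun n => ?_
    rw [show α + 2 = (α + 1) + 1 by ring, ← besselCoeff_succ]
    push_cast
    ring
  rw [h4, besselSeries, besselSeries, ← tsum_mul_left, ← h3.tsum_add (h1.mul_left _)]
  refine tsum_congr fun n => ?_
  rw [← besselCoeff_add_one hα]
  ring

theorem contDiff_tildeI {α : ℝ} (hα : 0 ≤ α) : ContDiff ℝ ∞ (tildeI α) := by
  rw [show tildeI α = fun z => besselSeries α ((z / 2) ^ 2) from funext (tildeI_eq α)]
  exact (contDiff_besselSeries hα).comp (by fun_prop)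

theorem tildeI_zero_pos {α : ℝ} (hα : 0 ≤ α) : 0 < tildeI α 0 := by
  rw [tildeI, tsum_eq_single 0 (fun n hn => by simp [hn])]
  simpa using Real.Gamma_pos_of_pos (by positivity : 0 < α + 1)

theorem hasDerivAt_tildeI {α : ℝ} (hα : 0 ≤ α) (z : ℝ) :
    HasDerivAt (tildeI α) (z / 2 * tildeI (α + 1) z) z := by
  rw [show tildeI α = fun z => besselSeries α ((z / 2) ^ 2) from funext (tildeI_eq α), tildeI_eq]
  have h := (hasDerivAt_besselSeries hα ((z / 2) ^ 2)).comp z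
    (((hasDerivAt_id z).div_const 2).pow 2)
  refine h.congr_deriv ?_
  simp
  ring

theorem hasDerivAt_tildeI_succ {α : ℝ} (hα : 0 ≤ α) {z : ℝ} (hz : 0 < z) :
    HasDerivAt (tildeI (α + 1)) (2 / z * tildeI α z - 2 * (α + 1) / z * tildeI (α + 1) z) z := by
  refine (hasDerivAt_tildeI (by positivity : 0 ≤ α + 1) z).congr_deriv ?_
  rw [tildeI_eq, tildeI_eq, tildeI_eq, ← besselSeries_recurrence hα,
    show α + 1 + 1 = α + 2 by ring]
  field_simp
  ring

/-! ### Euler derivatives -/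

/-- `f' = θ f` on `s`, where `θ = x·d/dx`. -/
def HasEulerOn (s : Set ℝ) (f f' : ℝ → ℝ) : Prop := ∀ x ∈ s, HasDerivAt f (f' x / x) x

namespace HasEulerOn

variable {s : Set ℝ} {f g f' g' : ℝ → ℝ}

theorem congr (h : HasEulerOn s f f') (h' : ∀ x ∈ s, g' x = f' x) : HasEulerOn s f g' :=
  fun x hx => by rw [h' x hx]; exact h x hx

theorem mul (hf : HasEulerOn s f f') (hg : HasEulerOn s g g') :
    HasEulerOn s (fun x => f x * g x) (fun x => f' x * g x + f x * g' x) :=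
  fun x hx => ((hf x hx).mul (hg x hx)).congr_deriv (by ring)

theorem add (hf : HasEulerOn s f f') (hg : HasEulerOn s g g') :
    HasEulerOn s (fun x => f x + g x) (fun x => f' x + g' x) :=
  fun x hx => ((hf x hx).add (hg x hx)).congr_deriv (by ring)

theorem const_mul (c : ℝ) (hf : HasEulerOn s f f') :
    HasEulerOn s (fun x => c * f x) (fun x => c * f' x) :=
  fun x hx => ((hf x hx).const_mul c).congr_deriv (by ring)

theorem pow (hs : s ⊆ Ioi 0) (n : ℕ) : HasEulerOn s (fun x => x ^ n) (fun x => n * x ^ n) :=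
  fun x hx => (hasDerivAt_pow n x).congr_deriv (by
    have : x ≠ 0 := (hs hx).ne'
    rcases n with _ | n
    · simp
    · simp only [Nat.add_sub_cancel, pow_succ]
      field_simp)

theorem comp_mul (hf : HasEulerOn (Ioi 0) f f') {c : ℝ} (hc : 0 < c) :
    HasEulerOn (Ioi 0) (fun x => f (c * x)) (fun x => f' (c * x)) := fun x hx => by
  have hx : 0 < x := hx
  have h := (hf (c * x) (mul_pos hc hx)).comp x ((hasDerivAt_id x).const_mul c)
  refine h.congr_deriv ?_
  field_simp

end HasEulerOn

theorem eulerOp_congr {u v : ℝ → ℝ} (h : EqOn u v (Ioi 0)) :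
    EqOn (eulerOp u) (eulerOp v) (Ioi 0) := fun x hx => by
  rw [eulerOp, eulerOp, h.deriv isOpen_Ioi hx]

theorem HasEulerOn.eulerOp_eq {u u' : ℝ → ℝ} (h : HasEulerOn (Ioi 0) u u') :
    EqOn (eulerOp u) u' (Ioi 0) := fun x hx => by
  have hx' : x ≠ 0 := ne_of_gt hx
  rw [eulerOp, (h x hx).deriv]
  field_simp

theorem quadOp_congr (a b : ℝ) {u v : ℝ → ℝ} (h : EqOn u v (Ioi 0)) :
    EqOn (quadOp a b u) (quadOp a b v) (Ioi 0) := fun x hx => by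
  have h2 := eulerOp_congr (u := fun y => eulerOp u y + b * u y)
    (v := fun y => eulerOp v y + b * v y) (fun y hy => by
      simp only [eulerOp_congr h hy, h hy]) hx
  simp only [quadOp, h2, eulerOp_congr h hx, h hx]

theorem Dop_congr (μ ν : ℝ) {u v : ℝ → ℝ} (h : EqOn u v (Ioi 0)) :
    EqOn (Dop μ ν u) (Dop μ ν v) (Ioi 0) := fun x hx => by
  simp only [Dop, quadOp_congr _ _ (quadOp_congr 0 ν h) hx]

theorem quadOp_eq (a b : ℝ) {u u₁ u₂ : ℝ → ℝ} (h₁ : HasEulerOn (Ioi 0) u u₁)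
    (h₂ : HasEulerOn (Ioi 0) u₁ u₂) :
    EqOn (quadOp a b u)
      (fun x => u₂ x + b * u₁ x + a * (u₁ x + b * u x) - x ^ 2 * u x) (Ioi 0) := fun x hx => by
  have h := eulerOp_congr (u := fun y => eulerOp u y + b * u y) (v := fun y => u₁ y + b * u y)
    (fun y hy => by simp only [h₁.eulerOp_eq hy]) hx
  simp only [quadOp, h, (h₂.add (h₁.const_mul b)).eulerOp_eq hx, h₁.eulerOp_eq hx]

/-! ### Solutions of the modified Bessel equation -/

/-- `A' = θA` and `θ(θ + σ)A = z²A` on `(0,∞)`. -/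
structure BesselPair (σ : ℝ) (A A' : ℝ → ℝ) : Prop where
  euler : HasEulerOn (Ioi 0) A A'
  euler' : HasEulerOn (Ioi 0) A' (fun z => z ^ 2 * A z - σ * A' z)

theorem besselPair_tildeI {α : ℝ} (hα : 0 ≤ α) :
    BesselPair (2 * α) (tildeI α) (fun z => z ^ 2 / 2 * tildeI (α + 1) z) where
  euler z hz := (hasDerivAt_tildeI hα z).congr_deriv (by
    have : z ≠ 0 := ne_of_gt hz
    field_simp)
  euler' z hz := (((hasDerivAt_pow 2 z).div_const 2).mul
    (hasDerivAt_tildeI_succ hα hz)).congr_deriv (by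
    have : z ≠ 0 := ne_of_gt hz
    simp
    field_simp
    ring)

theorem besselPair_tildeK (α : ℝ) :
    BesselPair (2 * α) (tildeK α) (fun z => -(z ^ 2 / 2) * tildeK (α + 1) z) where
  euler z hz := (hasDerivAt_tildeK α hz).congr_deriv (by
    have : z ≠ 0 := ne_of_gt hz
    field_simp)
  euler' z hz := (((hasDerivAt_pow 2 z).div_const 2).neg.mul
    (hasDerivAt_tildeK_succ α hz)).congr_deriv (by
    have : z ≠ 0 := ne_of_gt hz
    simp
    field_simp
    ring)

/-- Multiplication by `z^σ` exchanges the exponents `0` and `-σ` at the origin. -/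
theorem BesselPair.rpow_mul {σ : ℝ} {A A' : ℝ → ℝ} (h : BesselPair σ A A') :
    BesselPair (-σ) (fun z => z ^ σ * A z) (fun z => z ^ σ * (σ * A z + A' z)) := by
  have hp : HasEulerOn (Ioi 0) (fun z : ℝ => z ^ σ) (fun z => σ * z ^ σ) := fun z hz => by
    have hz : z ≠ 0 := ne_of_gt hz
    refine (Real.hasDerivAt_rpow_const (Or.inl hz)).congr_deriv ?_
    rw [Real.rpow_sub_one hz]
    ring
  refine ⟨(hp.mul h.euler).congr fun z _ => by ring,
    (hp.mul ((h.euler.const_mul σ).add h.euler')).congr fun z _ => by ring⟩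

/-- The product `(1-t)^a · ((1-t)/x)^k · P(tx/(1-t)) · B(x/(1-t))`. -/
def besselProduct (a : ℝ) (k : ℕ) (P B : ℝ → ℝ) (p : ℝ × ℝ) : ℝ :=
  (1 - p.1) ^ a * ((1 - p.1) / p.2) ^ k * P (p.1 * p.2 / (1 - p.1)) * B (p.2 / (1 - p.1))

theorem besselProduct_eq (a : ℝ) {k : ℕ} {A P : ℝ → ℝ} (B : ℝ → ℝ)
    (hP : ∀ z, 0 < z → z ^ k * A z = P z) {t x : ℝ} (ht : t ∈ Ioo (0 : ℝ) 1) (hx : 0 < x) :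
    besselProduct a k P B (t, x)
      = t ^ k * ((1 - t) ^ a * A (t * x / (1 - t)) * B (x / (1 - t))) := by
  have h1 : 0 < 1 - t := by linarith [ht.2]
  have h0 := ht.1
  rw [besselProduct, ← hP _ (by positivity)]
  simp only [div_pow, mul_pow]
  field_simp

/-- The action of `D_{μ,ν}` on a product of Bessel functions with arguments `βx` and `(β+1)x`. -/
theorem Dop_mul {μ ν β κ : ℝ} (hβ : 0 < β) {A A' B B' : ℝ → ℝ}
    (hA : BesselPair μ A A') (hB : BesselPair ν B B') {x : ℝ} (hx : 0 < x) {a a' b b' : ℝ}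
    (ha : A (β * x) = a) (ha' : A' (β * x) = a') (hb : B ((β + 1) * x) = b)
    (hb' : B' ((β + 1) * x) = b') :
    Dop μ ν (fun y => κ * (A (β * y) * B ((β + 1) * y))) x =
      4 * κ * ((μ + 1 + (μ + ν + 2) / 2 * β) *
          ((μ + ν + 2) / 2 * β * a * b + (β + 1) * a' * b + β * a * b')
        + ((μ + ν + 2) / 2 * ((β + 1) * β * a * b + β * ((β + 1) * a' * b + β * a * b'))
          + (β + 1) * β * a' * b
          + (β + 1) * ((β + 1) * (β ^ 2 * x ^ 2 * a - μ * a') * b + β * a' * b')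
          + (β + 1) * β * a * b'
          + β * ((β + 1) * a' * b' + a * β * ((β + 1) ^ 2 * x ^ 2 * b - ν * b')))) := by
  have hγ : 0 < β + 1 := by linarith
  have a₁ := hA.euler.comp_mul hβ
  have a₂ := hA.euler'.comp_mul hβ
  have b₁ := hB.euler.comp_mul hγ
  have b₂ := hB.euler'.comp_mul hγ
  have x₂ := HasEulerOn.pow (s := Ioi 0) subset_rfl 2
  have hu₁ := (a₁.mul b₁).const_mul κ
  have hu₂ := ((a₂.mul b₁).add (a₁.mul b₂)).const_mul κ
  have hv₁ := ((((x₂.mul (a₁.mul b₁)).const_mul (2 * β * (β + 1))).add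
    ((a₂.mul b₁).const_mul (ν - μ))).add ((a₂.mul b₂).const_mul 2)).const_mul κ
  have a₃ : HasEulerOn (Ioi 0) (fun y => (β * y) ^ 2 * A (β * y) - μ * A' (β * y))
      (fun y => 2 * β ^ 2 * y ^ 2 * A (β * y) + β ^ 2 * y ^ 2 * A' (β * y)
        - μ * ((β * y) ^ 2 * A (β * y) - μ * A' (β * y))) := fun y hy => by
    refine ((((x₂.mul a₁).const_mul (β ^ 2)).add (a₂.const_mul (-μ))) y hy
      |>.congr_of_eventuallyEq (Eventually.of_forall fun y => by ring)).congr_deriv ?_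
    push_cast
    ring
  have b₃ : HasEulerOn (Ioi 0)
      (fun y => ((β + 1) * y) ^ 2 * B ((β + 1) * y) - ν * B' ((β + 1) * y))
      (fun y => 2 * (β + 1) ^ 2 * y ^ 2 * B ((β + 1) * y)
        + (β + 1) ^ 2 * y ^ 2 * B' ((β + 1) * y)
        - ν * (((β + 1) * y) ^ 2 * B ((β + 1) * y) - ν * B' ((β + 1) * y))) := fun y hy => by
    refine ((((x₂.mul b₁).const_mul ((β + 1) ^ 2)).add (b₂.const_mul (-ν))) y hy
      |>.congr_of_eventuallyEq (Eventually.of_forall fun y => by ring)).congr_deriv ?_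
    push_cast
    ring
  have hv₂ := ((((((x₂.const_mul ((2 : ℕ) : ℝ)).mul (a₁.mul b₁)).add
      (x₂.mul ((a₂.mul b₁).add (a₁.mul b₂)))).const_mul (2 * β * (β + 1))).add
    (((a₃.mul b₁).add (a₂.mul b₂)).const_mul (ν - μ))).add
    (((a₃.mul b₂).add (a₂.mul b₃)).const_mul 2)).const_mul κ
  have hv : EqOn (quadOp 0 ν (fun y => κ * (A (β * y) * B ((β + 1) * y))))
      (fun x => κ * (2 * β * (β + 1) * (x ^ 2 * (A (β * x) * B ((β + 1) * x)))
        + (ν - μ) * (A' (β * x) * B ((β + 1) * x)) + 2 * (A' (β * x) * B' ((β + 1) * x))))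
      (Ioi 0) := fun y hy => by
    rw [quadOp_eq 0 ν hu₁ hu₂ hy]
    ring
  rw [Dop, quadOp_congr _ _ hv hx, quadOp_eq _ _ hv₁ hv₂ hx]
  have hx' : x ≠ 0 := hx.ne'
  simp only [ha, ha', hb, hb']
  rw [div_eq_iff (by positivity)]
  push_cast
  ring

theorem besselProduct_pde {μ ν : ℝ} {A A' B B' P : ℝ → ℝ} {k : ℕ}
    (hA : BesselPair μ A A') (hB : BesselPair ν B B')
    (hP : ∀ z, 0 < z → z ^ k * A z = P z) {x : ℝ} (hx : 0 < x) :
    ∃ H₁ H₂ : ℝ → ℝ,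
      HasEulerOn (Ioo 0 1) (fun t => besselProduct (-(μ + ν + 2) / 2) k P B (t, x)) H₁ ∧
      HasEulerOn (Ioo 0 1) H₁ H₂ ∧
      ∀ t ∈ Ioo (0 : ℝ) 1,
        Dop μ ν (fun y => besselProduct (-(μ + ν + 2) / 2) k P B (t, y)) x =
          4 * (H₂ t + (μ + 1 - 2 * k) * H₁ t
            + (k ^ 2 - k * (μ + 1)) * besselProduct (-(μ + ν + 2) / 2) k P B (t, x)) := by
  set S := Ioo (0 : ℝ) 1
  have hS : S ⊆ Ioi 0 := fun t ht => ht.1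
  have hc : HasEulerOn S (fun t => t / (1 - t)) (fun t => t / (1 - t) * (t / (1 - t) + 1)) :=
    fun t ht => by
      have h1 : 1 - t ≠ 0 := by linarith [ht.2]
      have h0 : t ≠ 0 := ht.1.ne'
      refine ((hasDerivAt_id t).div ((hasDerivAt_id t).const_sub 1) h1).congr_deriv ?_
      simp
      field_simp
      ring
  have hc' : HasEulerOn S (fun t => t / (1 - t) + 1) (fun t => t / (1 - t) * (t / (1 - t) + 1)) :=
    fun t ht => (hc t ht).add_const 1
  have hκ : HasEulerOn S (fun t => (1 - t) ^ (-(μ + ν + 2) / 2))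
      (fun t => (μ + ν + 2) / 2 * ((t / (1 - t)) * (1 - t) ^ (-(μ + ν + 2) / 2))) := fun t ht => by
    have h1 : 1 - t ≠ 0 := by linarith [ht.2]
    have h0 : t ≠ 0 := ht.1.ne'
    refine (((hasDerivAt_id t).const_sub 1).rpow_const (Or.inl h1)).congr_deriv ?_
    simp only [id]
    rw [Real.rpow_sub_one h1]
    field_simp
  have hcomp : ∀ {f f' g g' : ℝ → ℝ}, HasEulerOn (Ioi 0) f f' → HasEulerOn S g g' →
      (∀ t ∈ S, 0 < g t) →
      HasEulerOn S (fun t => f (g t * x)) (fun t => f' (g t * x) * (g' t / g t)) := by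
    intro f f' g g' hf hg hpos t ht
    have hgt := hpos t ht
    have h0 : t ≠ 0 := ht.1.ne'
    refine ((hf _ (mul_pos hgt hx)).comp t ((hg t ht).mul_const x)).congr_deriv ?_
    field_simp
  have hβ : ∀ t ∈ S, 0 < t / (1 - t) := fun t ht => div_pos ht.1 (by linarith [ht.2])
  have hγ : ∀ t ∈ S, 0 < t / (1 - t) + 1 := fun t ht => by linarith [hβ t ht]
  have a₁ := (hcomp hA.euler hc hβ).congr
    (g' := fun t => (t / (1 - t) + 1) * A' (t / (1 - t) * x)) fun t ht => by
      have := (hβ t ht).ne'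
      rw [mul_div_cancel_left₀ _ this]; ring
  have a₂ := (hcomp hA.euler' hc hβ).congr
    (g' := fun t => (t / (1 - t) + 1) * ((t / (1 - t) * x) ^ 2 * A (t / (1 - t) * x)
      - μ * A' (t / (1 - t) * x))) fun t ht => by
      have := (hβ t ht).ne'
      rw [mul_div_cancel_left₀ _ this]; ring
  have b₁ := (hcomp hB.euler hc' hγ).congr
    (g' := fun t => (t / (1 - t)) * B' ((t / (1 - t) + 1) * x)) fun t ht => by
      have := (hγ t ht).ne'
      rw [mul_div_cancel_right₀ _ this]; ring
  have b₂ := (hcomp hB.euler' hc' hγ).congr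
    (g' := fun t => (t / (1 - t)) * (((t / (1 - t) + 1) * x) ^ 2 * B ((t / (1 - t) + 1) * x)
      - ν * B' ((t / (1 - t) + 1) * x))) fun t ht => by
      have := (hγ t ht).ne'
      rw [mul_div_cancel_right₀ _ this]; ring
  have hG := (hκ.mul (a₁.mul b₁))
  have hG₁ := ((((hc.mul hκ).const_mul ((μ + ν + 2) / 2)).mul (a₁.mul b₁))).add
    (hκ.mul (((hc'.mul a₂).mul b₁).add (a₁.mul (hc.mul b₂))))
  have hk := HasEulerOn.pow hS k
  have hH₁ := hk.mul hG
  have hH₂ := ((hk.const_mul k).mul hG).add (hk.mul hG₁)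
  refine ⟨_, _, fun t ht => (hH₁ t ht).congr_of_eventuallyEq ?_, hH₂, fun t ht => ?_⟩
  · filter_upwards [isOpen_Ioo.mem_nhds ht] with s hs
    have h1 : 1 - s ≠ 0 := by linarith [hs.2]
    rw [besselProduct_eq _ B hP hs hx,
      show s / (1 - s) + 1 = 1 / (1 - s) by field_simp; ring]
    ring_nf
  · have h1 : 1 - t ≠ 0 := by linarith [ht.2]
    have hγ' : t / (1 - t) + 1 = 1 / (1 - t) := by field_simp; ring
    have hcongr : EqOn (fun y => besselProduct (-(μ + ν + 2) / 2) k P B (t, y))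
        (fun y => (t ^ k * (1 - t) ^ (-(μ + ν + 2) / 2)) *
          (A (t / (1 - t) * y) * B ((t / (1 - t) + 1) * y))) (Ioi 0) := fun y hy => by
      simp only
      rw [besselProduct_eq _ B hP ht hy, hγ']
      ring_nf
    have hx' := hcongr hx
    simp only at hx'
    rw [Dop_congr μ ν hcongr hx, hx', Dop_mul (hβ t ht) hA hB hx rfl rfl rfl rfl]
    ring

/-! ### Partial derivatives of functions of two variables -/

/-- The partial derivative in the first variable. -/
def partialFst (F : ℝ × ℝ → ℝ) (p : ℝ × ℝ) : ℝ := deriv (fun t => F (t, p.2)) p.1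

/-- The partial derivative in the second variable. -/
def partialSnd (F : ℝ × ℝ → ℝ) (p : ℝ × ℝ) : ℝ := deriv (fun y => F (p.1, y)) p.2

theorem iteratedDeriv_eq_partialFst_iterate (F : ℝ × ℝ → ℝ) (n : ℕ) (t x : ℝ) :
    iteratedDeriv n (fun s => F (s, x)) t = partialFst^[n] F (t, x) := by
  induction n generalizing t with
  | zero => simp
  | succ n ih =>
    rw [iteratedDeriv_succ, Function.iterate_succ_apply', partialFst]
    exact congrArg (fun f => deriv f t) (funext ih)

section

variable {U : Set (ℝ × ℝ)} {F G : ℝ × ℝ → ℝ}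

theorem hasDerivAt_slice_fst {p : ℝ × ℝ} (h : DifferentiableAt ℝ F p) :
    HasDerivAt (fun t => F (t, p.2)) (fderiv ℝ F p (1, 0)) p.1 :=
  h.hasFDerivAt.comp_hasDerivAt p.1 ((hasDerivAt_id p.1).prodMk (hasDerivAt_const p.1 p.2))

theorem hasDerivAt_slice_snd {p : ℝ × ℝ} (h : DifferentiableAt ℝ F p) :
    HasDerivAt (fun y => F (p.1, y)) (fderiv ℝ F p (0, 1)) p.2 :=
  h.hasFDerivAt.comp_hasDerivAt p.2 ((hasDerivAt_const p.2 p.1).prodMk (hasDerivAt_id p.2))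

theorem partialFst_eq {p : ℝ × ℝ} (h : DifferentiableAt ℝ F p) :
    partialFst F p = fderiv ℝ F p (1, 0) := (hasDerivAt_slice_fst h).deriv

theorem partialSnd_eq {p : ℝ × ℝ} (h : DifferentiableAt ℝ F p) :
    partialSnd F p = fderiv ℝ F p (0, 1) := (hasDerivAt_slice_snd h).deriv

theorem differentiableAt_of_smooth (hU : IsOpen U) (hF : ContDiffOn ℝ ∞ F U) {p : ℝ × ℝ}
    (hp : p ∈ U) : DifferentiableAt ℝ F p :=
  (hF.contDiffAt (hU.mem_nhds hp)).differentiableAt (by simp)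

theorem smooth_fderiv_apply (hU : IsOpen U) (hF : ContDiffOn ℝ ∞ F U) (v : ℝ × ℝ) :
    ContDiffOn ℝ ∞ (fun p => fderiv ℝ F p v) U :=
  (hF.fderiv_of_isOpen hU (by simp)).clm_apply contDiffOn_const

theorem smooth_partialFst (hU : IsOpen U) (hF : ContDiffOn ℝ ∞ F U) :
    ContDiffOn ℝ ∞ (partialFst F) U :=
  (smooth_fderiv_apply hU hF (1, 0)).congr fun _ hp =>
    partialFst_eq (differentiableAt_of_smooth hU hF hp)

theorem smooth_partialSnd (hU : IsOpen U) (hF : ContDiffOn ℝ ∞ F U) :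
    ContDiffOn ℝ ∞ (partialSnd F) U :=
  (smooth_fderiv_apply hU hF (0, 1)).congr fun _ hp =>
    partialSnd_eq (differentiableAt_of_smooth hU hF hp)

theorem smooth_partialFst_iterate (hU : IsOpen U) (hF : ContDiffOn ℝ ∞ F U) (n : ℕ) :
    ContDiffOn ℝ ∞ (partialFst^[n] F) U := by
  induction n generalizing F with
  | zero => exact hF
  | succ n ih => exact ih (smooth_partialFst hU hF)

theorem partialFst_congr (hU : IsOpen U) (h : EqOn F G U) :
    EqOn (partialFst F) (partialFst G) U := fun p hp => by
  refine Filter.EventuallyEq.deriv_eq ?_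
  have : ContinuousAt (fun t : ℝ => (t, p.2)) p.1 := by fun_prop
  filter_upwards [this.preimage_mem_nhds (hU.mem_nhds hp)] with t ht using h ht

theorem partialSnd_congr (hU : IsOpen U) (h : EqOn F G U) :
    EqOn (partialSnd F) (partialSnd G) U := fun p hp => by
  refine Filter.EventuallyEq.deriv_eq ?_
  have : ContinuousAt (fun y : ℝ => (p.1, y)) p.2 := by fun_prop
  filter_upwards [this.preimage_mem_nhds (hU.mem_nhds hp)] with t ht using h ht

theorem partialFst_iterate_congr (hU : IsOpen U) (h : EqOn F G U) (n : ℕ) :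
    EqOn (partialFst^[n] F) (partialFst^[n] G) U := by
  induction n generalizing F G with
  | zero => exact h
  | succ n ih => exact ih (partialFst_congr hU h)

theorem partialFst_partialSnd (hU : IsOpen U) (hF : ContDiffOn ℝ ∞ F U) :
    EqOn (partialFst (partialSnd F)) (partialSnd (partialFst F)) U := fun p hp => by
  have hd := fun (v : ℝ × ℝ) => differentiableAt_of_smooth hU (smooth_fderiv_apply hU hF v) hp
  have hF' : DifferentiableAt ℝ (fderiv ℝ F) p :=
    ((hF.fderiv_of_isOpen hU (m := ∞) (by simp)).contDiffAt (hU.mem_nhds hp)).differentiableAt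
      (by simp)
  rw [partialFst_congr hU (G := fun p => fderiv ℝ F p (0, 1))
      (fun q hq => partialSnd_eq (differentiableAt_of_smooth hU hF hq)) hp,
    partialSnd_congr hU (G := fun p => fderiv ℝ F p (1, 0))
      (fun q hq => partialFst_eq (differentiableAt_of_smooth hU hF hq)) hp,
    partialFst_eq (hd _), partialSnd_eq (hd _),
    fderiv_clm_apply hF' (differentiableAt_const _), fderiv_clm_apply hF' (differentiableAt_const _)]
  have hs := (hF.contDiffAt (hU.mem_nhds hp)).isSymmSndFDerivAt (by
    rw [minSmoothness_of_isRCLikeNormedField]; exact WithTop.coe_le_coe.2 (le_top : (2 : ℕ∞) ≤ ⊤))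
  simpa using hs.eq (1, 0) (0, 1)

theorem partialFst_add (hU : IsOpen U) (hF : ContDiffOn ℝ ∞ F U) (hG : ContDiffOn ℝ ∞ G U) :
    EqOn (partialFst fun p => F p + G p) (fun p => partialFst F p + partialFst G p) U :=
  fun _ hp => deriv_add
    (hasDerivAt_slice_fst (differentiableAt_of_smooth hU hF hp)).differentiableAt
    (hasDerivAt_slice_fst (differentiableAt_of_smooth hU hG hp)).differentiableAt

theorem partialFst_mul_left (g : ℝ → ℝ) (F : ℝ × ℝ → ℝ) :
    partialFst (fun p => g p.2 * F p) = fun p => g p.2 * partialFst F p :=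
  funext fun _ => by simp only [partialFst]; exact deriv_const_mul_field _

/-- An operator on functions of two variables which preserves smoothness on `U` and commutes there
with the derivative in the first variable. -/
structure CommutesFst (U : Set (ℝ × ℝ)) (T : (ℝ × ℝ → ℝ) → ℝ × ℝ → ℝ) : Prop where
  congr : ∀ ⦃F G⦄, EqOn F G U → EqOn (T F) (T G) U
  smooth : ∀ ⦃F⦄, ContDiffOn ℝ ∞ F U → ContDiffOn ℝ ∞ (T F) U
  comm : ∀ ⦃F⦄, ContDiffOn ℝ ∞ F U → EqOn (partialFst (T F)) (T (partialFst F)) U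

namespace CommutesFst

variable {S T : (ℝ × ℝ → ℝ) → ℝ × ℝ → ℝ}

theorem id : CommutesFst U fun F => F := ⟨fun _ _ h => h, fun _ h => h, fun _ _ _ _ => rfl⟩

theorem comp (hS : CommutesFst U S) (hT : CommutesFst U T) :
    CommutesFst U fun F => S (T F) :=
  ⟨fun _ _ h => hS.congr (hT.congr h), fun _ h => hS.smooth (hT.smooth h),
    fun _ h => (hS.comm (hT.smooth h)).trans (hS.congr (hT.comm h))⟩

theorem add (hU : IsOpen U) (hS : CommutesFst U S) (hT : CommutesFst U T) :
    CommutesFst U fun F p => S F p + T F p :=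
  ⟨fun _ _ h p hp => by simp only [hS.congr h hp, hT.congr h hp],
    fun _ h => (hS.smooth h).add (hT.smooth h),
    fun _ h p hp => by
      rw [partialFst_add hU (hS.smooth h) (hT.smooth h) hp]
      simp only [hS.comm h hp, hT.comm h hp]⟩

theorem mul_left {g : ℝ → ℝ} (hg : ContDiffOn ℝ ∞ (fun p : ℝ × ℝ => g p.2) U)
    (hT : CommutesFst U T) : CommutesFst U fun F p => g p.2 * T F p :=
  ⟨fun _ _ h p hp => by simp only [hT.congr h hp],
    fun _ h => hg.mul (hT.smooth h),
    fun _ h p hp => by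
      rw [partialFst_mul_left]
      simp only [hT.comm h hp]⟩

theorem partialSnd (hU : IsOpen U) : CommutesFst U partialSnd :=
  ⟨fun _ _ h => partialSnd_congr hU h, fun _ h => smooth_partialSnd hU h,
    fun _ h => partialFst_partialSnd hU h⟩

theorem iterate (hU : IsOpen U) (hT : CommutesFst U T) (hF : ContDiffOn ℝ ∞ F U) (n : ℕ) :
    EqOn (partialFst^[n] (T F)) (T (partialFst^[n] F)) U := by
  induction n generalizing F with
  | zero => exact fun _ _ => rfl
  | succ n ih =>
    exact (partialFst_iterate_congr hU (hT.comm hF) n).trans (ih (smooth_partialFst hU hF))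

/-- The operator `D_{μ,ν}` in the second variable. -/
theorem Dop (hU : IsOpen U) (hpos : ∀ p ∈ U, 0 < p.2) (μ ν : ℝ) :
    CommutesFst U fun F p => Dop μ ν (fun y => F (p.1, y)) p.2 := by
  have hE : CommutesFst U fun F p => eulerOp (fun y => F (p.1, y)) p.2 :=
    mul_left (g := fun y => y) (by fun_prop) (CommutesFst.partialSnd hU)
  have hc : ∀ (c : ℝ) {T}, CommutesFst U T → CommutesFst U fun F p => c * T F p :=
    fun c T hT => mul_left (g := fun _ => c) (by fun_prop) hT
  have hQ : ∀ a b, CommutesFst U fun F p => quadOp a b (fun y => F (p.1, y)) p.2 := by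
    intro a b
    have h1 := hE.add hU (hc b id)
    have h2 := ((comp hE h1).add hU (hc a h1)).add hU
      (mul_left (g := fun y => -y ^ 2) (by fun_prop) id)
    simpa only [quadOp, sub_eq_add_neg, ← neg_mul] using h2
  have h := mul_left (g := fun y => (y ^ 2)⁻¹) (ContDiffOn.inv (by fun_prop) fun p hp => by
    have := hpos p hp; positivity) (comp (hQ (μ + ν) μ) (hQ 0 ν))
  simpa only [_root_.Dop, div_eq_inv_mul] using h

end CommutesFst

theorem partialFst_fst_mul (hU : IsOpen U) (hF : ContDiffOn ℝ ∞ F U) :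
    EqOn (partialFst fun p => p.1 * F p) (fun p => F p + p.1 * partialFst F p) U := fun p hp => by
  have h := (hasDerivAt_id p.1).mul (hasDerivAt_slice_fst (differentiableAt_of_smooth hU hF hp))
  refine (h.deriv).trans ?_
  simp only [id, one_mul, partialFst_eq (differentiableAt_of_smooth hU hF hp)]

theorem partialFst_iterate_euler (hU : IsOpen U) (hF : ContDiffOn ℝ ∞ F U) (n : ℕ) :
    EqOn (partialFst^[n] fun p => p.1 * partialFst F p)
      (fun p => p.1 * partialFst^[n + 1] F p + n * partialFst^[n] F p) U := by
  induction n with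
  | zero => intro p _; simp
  | succ n ih =>
    intro p hp
    have hs := smooth_partialFst_iterate hU hF
    rw [Function.iterate_succ_apply', partialFst_congr hU ih hp,
      partialFst_add hU (F := fun p => p.1 * partialFst^[n + 1] F p)
        (contDiff_fst.contDiffOn.mul (hs (n + 1)))
        (contDiffOn_const.mul (hs n)) hp]
    simp only
    rw [partialFst_fst_mul hU (hs (n + 1)) hp, partialFst_mul_left (fun _ => (n : ℝ))]
    simp only [← Function.iterate_succ_apply' partialFst]
    push_cast
    ring

theorem partialFst_iterate_add (hU : IsOpen U) (hF : ContDiffOn ℝ ∞ F U) (hG : ContDiffOn ℝ ∞ G U)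
    (n : ℕ) :
    EqOn (partialFst^[n] fun p => F p + G p) (fun p => partialFst^[n] F p + partialFst^[n] G p) U := by
  induction n generalizing F G with
  | zero => exact fun _ _ => rfl
  | succ n ih =>
    exact (partialFst_iterate_congr hU (partialFst_add hU hF hG) n).trans
      (ih (smooth_partialFst hU hF) (smooth_partialFst hU hG))

theorem partialFst_iterate_mul_left (g : ℝ → ℝ) (F : ℝ × ℝ → ℝ) (n : ℕ) :
    partialFst^[n] (fun p => g p.2 * F p) = fun p => g p.2 * partialFst^[n] F p := by
  induction n generalizing F with
  | zero => rfl
  | succ n ih => rw [Function.iterate_succ_apply, partialFst_mul_left, ih]; rfl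

end

theorem eq_of_eqOn_of_mem_closure {U V : Set (ℝ × ℝ)} {F G : ℝ × ℝ → ℝ}
    (hF : ContinuousOn F U) (hG : ContinuousOn G U) (hVU : V ⊆ U) (h : EqOn F G V) {p : ℝ × ℝ}
    (hp : p ∈ U) (hpV : p ∈ closure V) : F p = G p :=
  h.of_subset_closure (t := insert p V) (hF.mono (insert_subset hp hVU))
    (hG.mono (insert_subset hp hVU)) (subset_insert _ _) (insert_subset hpV subset_closure)
    (mem_insert _ _)

/-- The operator `4(θ - k)(θ - k + μ + 1)` with `θ = t·∂/∂t` acts on the `n`-th Taylor coefficient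
at `t = 0` as multiplication by `4(n - k)(n - k + μ + 1)`. -/
theorem Dop_iteratedDeriv {U : Set (ℝ × ℝ)} (hU : IsOpen U) (hpos : ∀ p ∈ U, 0 < p.2)
    {H : ℝ × ℝ → ℝ} (hH : ContDiffOn ℝ ∞ H U) {V : Set (ℝ × ℝ)} (hV : IsOpen V) (hVU : V ⊆ U)
    {μ ν k x : ℝ} (hx : (0, x) ∈ U) (hxV : (0, x) ∈ closure V)
    (hD : EqOn (fun p => Dop μ ν (fun y => H (p.1, y)) p.2)
      (fun p => 4 * (p.1 * partialFst (fun p => p.1 * partialFst H p) p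
        + ((μ + 1 - 2 * k) * (p.1 * partialFst H p) + (k ^ 2 - k * (μ + 1)) * H p))) V) (n : ℕ) :
    Dop μ ν (fun y => iteratedDeriv n (fun t => H (t, y)) 0) x
      = 4 * (n - k) * (n - k + μ + 1) * iteratedDeriv n (fun t => H (t, x)) 0 := by
  have hT := CommutesFst.Dop hU hpos μ ν
  have hEs : ∀ {F}, ContDiffOn ℝ ∞ F U → ContDiffOn ℝ ∞ (fun p => p.1 * partialFst F p) U :=
    fun hF => contDiff_fst.contDiffOn.mul (smooth_partialFst hU hF)
  have hc : ∀ (c : ℝ) {F}, ContDiffOn ℝ ∞ F U → ContDiffOn ℝ ∞ (fun p => c * F p) U :=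
    fun c F hF => contDiffOn_const.mul hF
  have hE1 := hEs hH
  have hE2 := hEs hE1
  have hs1 := (hc (μ + 1 - 2 * k) hE1).add (hc (k ^ 2 - k * (μ + 1)) hH)
  have hs := hc 4 (hE2.add hs1)
  have heq := partialFst_iterate_congr hV hD n
  have key := eq_of_eqOn_of_mem_closure (smooth_partialFst_iterate hU (hT.smooth hH) n).continuousOn
    (smooth_partialFst_iterate hU hs n).continuousOn hVU heq hx hxV
  rw [hT.iterate hU hH n hx, partialFst_iterate_mul_left (fun _ => (4 : ℝ))] at key
  simp only at key
  rw [partialFst_iterate_add hU hE2 hs1 n hx] at key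
  simp only at key
  rw [partialFst_iterate_add hU (hc _ hE1) (hc _ hH) n hx] at key
  simp only at key
  rw [partialFst_iterate_mul_left (fun _ => μ + 1 - 2 * k),
    partialFst_iterate_mul_left (fun _ => k ^ 2 - k * (μ + 1)),
    partialFst_iterate_euler hU hE1 n hx] at key
  simp only at key
  rw [partialFst_iterate_euler hU hH n hx] at key
  simp only [iteratedDeriv_eq_partialFst_iterate]
  rw [key]
  ring

/-! ### Taylor coefficients of Bessel products -/

theorem smooth_besselProduct (a : ℝ) (k : ℕ) {P B : ℝ → ℝ} (hP : ContDiff ℝ ∞ P)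
    (hB : ContDiffOn ℝ ∞ B (Ioi 0)) :
    ContDiffOn ℝ ∞ (besselProduct a k P B) (Iio 1 ×ˢ Ioi 0) := by
  have h1 : ∀ p ∈ (Iio 1 ×ˢ Ioi 0 : Set (ℝ × ℝ)), 0 < 1 - p.1 := fun p hp => by
    have := hp.1
    simp only [mem_Iio] at this
    linarith
  have h2 : ∀ p ∈ (Iio 1 ×ˢ Ioi 0 : Set (ℝ × ℝ)), 0 < p.2 := fun p hp => hp.2
  have hs : ContDiffOn ℝ ∞ (fun p : ℝ × ℝ => 1 - p.1) (Iio 1 ×ˢ Ioi 0) := by fun_prop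
  have hx : ContDiffOn ℝ ∞ (fun p : ℝ × ℝ => p.2) (Iio 1 ×ˢ Ioi 0) := by fun_prop
  have ht : ContDiffOn ℝ ∞ (fun p : ℝ × ℝ => p.1) (Iio 1 ×ˢ Ioi 0) := by fun_prop
  refine (((hs.rpow_const_of_ne fun p hp => (h1 p hp).ne').mul
    ((hs.div hx fun p hp => (h2 p hp).ne').pow k)).mul
    (hP.comp_contDiffOn ((ht.mul hx).div hs fun p hp => (h1 p hp).ne'))).mul
    (hB.comp (hx.div hs fun p hp => (h1 p hp).ne') fun p hp => div_pos (h2 p hp) (h1 p hp))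

theorem Dop_iteratedDeriv_besselProduct {μ ν : ℝ} {A A' B B' P : ℝ → ℝ} {k : ℕ}
    (hA : BesselPair μ A A') (hB : BesselPair ν B B')
    (hP : ∀ z, 0 < z → z ^ k * A z = P z) (hPs : ContDiff ℝ ∞ P)
    (hBs : ContDiffOn ℝ ∞ B (Ioi 0)) (n : ℕ) {x : ℝ} (hx : 0 < x) :
    Dop μ ν
        (fun y => iteratedDeriv n (fun t => besselProduct (-(μ + ν + 2) / 2) k P B (t, y)) 0) x
      = 4 * (n - k) * (n - k + μ + 1) *
        iteratedDeriv n (fun t => besselProduct (-(μ + ν + 2) / 2) k P B (t, x)) 0 := by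
  set H := besselProduct (-(μ + ν + 2) / 2) k P B
  refine Dop_iteratedDeriv (U := Iio 1 ×ˢ Ioi 0) (V := Ioo 0 1 ×ˢ Ioi 0)
    (isOpen_Iio.prod isOpen_Ioi) (fun p hp => hp.2) (smooth_besselProduct _ k hPs hBs)
    (isOpen_Ioo.prod isOpen_Ioi) (prod_mono (fun t ht => ht.2) subset_rfl) (k := (k : ℝ))
    ⟨by simp, hx⟩ ?_ ?_ n
  · rw [closure_prod_eq, closure_Ioo zero_ne_one]
    exact ⟨by simp, subset_closure hx⟩
  · rintro ⟨t, y⟩ ⟨ht, hy⟩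
    obtain ⟨H₁, H₂, h₁, h₂, h⟩ := besselProduct_pde hA hB hP hy
    have e₁ : ∀ s ∈ Ioo (0 : ℝ) 1, s * partialFst H (s, y) = H₁ s := fun s hs => by
      have : s ≠ 0 := hs.1.ne'
      rw [partialFst, (h₁ s hs).deriv]
      field_simp
    have e₂ : t * partialFst (fun p => p.1 * partialFst H p) (t, y) = H₂ t := by
      have ht0 : t ≠ 0 := ht.1.ne'
      have : (fun s => s * partialFst H (s, y)) =ᶠ[𝓝 t] H₁ := by
        filter_upwards [isOpen_Ioo.mem_nhds ht] with s hs using e₁ s hs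
      rw [partialFst]
      simp only
      rw [this.deriv_eq, (h₂ t ht).deriv]
      field_simp
    simp only
    rw [h t ht, e₂, e₁ t ht]
    ring

theorem limUnder_iteratedDeriv_besselProduct (a : ℝ) {k : ℕ} {A B P : ℝ → ℝ}
    (hP : ∀ z, 0 < z → z ^ k * A z = P z) (hPs : ContDiff ℝ ∞ P)
    (hBs : ContDiffOn ℝ ∞ B (Ioi 0)) (n : ℕ) {x : ℝ} (hx : 0 < x) :
    limUnder (𝓝[>] (0 : ℝ)) (fun t => iteratedDeriv n
        (fun s => s ^ k * ((1 - s) ^ a * A (s * x / (1 - s)) * B (x / (1 - s)))) t)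
      = iteratedDeriv n (fun t => besselProduct a k P B (t, x)) 0 := by
  have hU : IsOpen (Iio (1 : ℝ) ×ˢ Ioi (0 : ℝ)) := isOpen_Iio.prod isOpen_Ioi
  refine Tendsto.limUnder_eq ?_
  have hc := ((smooth_partialFst_iterate hU (smooth_besselProduct a k hPs hBs) n).continuousOn
    |>.continuousAt (hU.mem_nhds (x := (0, x)) ⟨by simp, hx⟩)).comp
    (f := fun t : ℝ => (t, x)) (x := 0) (by fun_prop)
  rw [iteratedDeriv_eq_partialFst_iterate]
  refine (hc.tendsto.mono_left nhdsWithin_le_nhds).congr' ?_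
  filter_upwards [Ioo_mem_nhdsGT (zero_lt_one' ℝ)] with t ht
  rw [Function.comp_apply, ← iteratedDeriv_eq_partialFst_iterate]
  refine Filter.EventuallyEq.iteratedDeriv_eq n ?_
  filter_upwards [isOpen_Ioo.mem_nhds ht] with s hs using besselProduct_eq a B hP hs hx

theorem quadOp_const_mul (a b c : ℝ) (u : ℝ → ℝ) :
    quadOp a b (fun y => c * u y) = fun y => c * quadOp a b u y := by
  have h : ∀ v : ℝ → ℝ, eulerOp (fun y => c * v y) = fun y => c * eulerOp v y := fun v => by
    funext y
    rw [eulerOp, eulerOp, deriv_const_mul_field]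
    ring
  funext x
  have e : (fun y => eulerOp (fun y => c * u y) y + b * (c * u y))
      = fun y => c * (eulerOp u y + b * u y) := by
    funext y
    rw [h]
    ring
  rw [quadOp, quadOp, e, h, h]
  ring

theorem Dop_const_mul (μ ν c : ℝ) (u : ℝ → ℝ) (x : ℝ) :
    Dop μ ν (fun y => c * u y) x = c * Dop μ ν u x := by
  rw [Dop, Dop, quadOp_const_mul, quadOp_const_mul, mul_div_assoc]

/-! ### Behaviour of the K-Bessel function at the origin -/

theorem hasDerivAt_rpow_mul_besselK (α : ℝ) {z : ℝ} (hz : 0 < z) :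
    HasDerivAt (fun z => z ^ α * besselK α z) (-(z ^ α * besselK (α - 1) z)) z := by
  refine ((Real.hasDerivAt_rpow_const (Or.inl hz.ne')).mul
    (hasDerivAt_besselK α hz)).congr_deriv ?_
  rw [Real.rpow_sub_one hz.ne']
  field_simp
  ring

theorem besselK_succ (α : ℝ) {z : ℝ} (hz : 0 < z) :
    besselK (α + 1) z = besselK (α - 1) z + 2 * α / z * besselK α z := by
  have h := (hasDerivAt_besselK α hz).unique (hasDerivAt_besselK' α hz)
  linear_combination h

theorem exists_contDiff_rpow_mul_besselK (k : ℕ) :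
    ∃ P : ℝ → ℝ, ContDiff ℝ ∞ P ∧
      ∀ z, 0 < z → z ^ ((k : ℝ) + 1 / 2) * besselK ((k : ℝ) + 1 / 2) z = P z := by
  induction k with
  | zero =>
    set q : ℝ → ℝ := fun z => z ^ (1 / 2 : ℝ) * besselK (1 / 2) z
    have hq : ∀ z, 0 < z → HasDerivAt q (-q z) z := fun z hz => by
      refine (hasDerivAt_rpow_mul_besselK (1 / 2) hz).congr_deriv ?_
      rw [show (1 / 2 - 1 : ℝ) = -(1 / 2) by norm_num, besselK_neg]
    have hd : ∀ z, 0 < z → HasDerivAt (fun z => q z * Real.exp z) 0 z := fun z hz =>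
      ((hq z hz).mul (Real.hasDerivAt_exp z)).congr_deriv (by ring)
    obtain ⟨c, hc⟩ := isOpen_Ioi.exists_is_const_of_deriv_eq_zero isPreconnected_Ioi
      (f := fun z => q z * Real.exp z) (s := Ioi (0 : ℝ))
      (fun z hz => (hd z hz).differentiableAt.differentiableWithinAt) (fun z hz => (hd z hz).deriv)
    refine ⟨fun z => c * Real.exp (-z), by fun_prop, fun z hz => ?_⟩
    simp only [Nat.cast_zero, zero_add]
    rw [← hc z hz, mul_assoc, ← Real.exp_add]
    simp [q]
  | succ k ih =>
    obtain ⟨P, hP, h⟩ := ih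
    set α : ℝ := (k : ℝ) + 1 / 2 with hα
    have hP' : ContDiff ℝ ∞ (deriv P) := (contDiff_infty_iff_deriv.1 hP).2
    refine ⟨fun z => 2 * α * P z - z * deriv P z, by fun_prop, fun z hz => ?_⟩
    have e : HasDerivAt P (-(z ^ α * besselK (α - 1) z)) z :=
      (hasDerivAt_rpow_mul_besselK α hz).congr_of_eventuallyEq <| by
        filter_upwards [isOpen_Ioi.mem_nhds hz] with y hy using (h y hy).symm
    simp only
    rw [e.deriv, ← h z hz, show ((k + 1 : ℕ) : ℝ) + 1 / 2 = α + 1 by push_cast; ring,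
      besselK_succ α hz, Real.rpow_add_one hz.ne']
    field_simp
    ring

theorem besselK_le_rpow {β γ : ℝ} (h : |β| < γ) :
    ∃ C, 0 < C ∧ ∀ z, 0 < z → besselK β z ≤ C * z ^ (-γ) := by
  have hγ : 0 < γ := (abs_nonneg β).trans_lt h
  have hint : IntegrableOn (fun s : ℝ => Real.exp (-(γ - |β|) * s)) (Ioi 0) :=
    exp_neg_integrableOn_Ioi 0 (by linarith)
  set J := ∫ s in Ioi (0 : ℝ), Real.exp (-(γ - |β|) * s)
  have hJ : 0 ≤ J := setIntegral_nonneg measurableSet_Ioi fun s _ => (Real.exp_pos _).le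
  refine ⟨(2 * γ) ^ γ * (J + 1), by positivity, fun z hz => ?_⟩
  have hb : ∀ s ∈ Ioi (0 : ℝ), Real.exp (-z * Real.cosh s) * Real.cosh (β * s)
      ≤ (2 * γ) ^ γ * z ^ (-γ) * Real.exp (-(γ - |β|) * s) := fun s hs => by
    have h1 := (le_abs_self _).trans (abs_cosh_mul_le (α := β) (le_of_lt hs))
    have h2 : Real.exp (-z * Real.cosh s) ≤ (2 * γ) ^ γ * z ^ (-γ) * Real.exp (-γ * s) := by
      have hw : z * Real.exp s / (2 * γ) ≤ Real.exp (z * Real.cosh s / γ) := by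
        have h3 := Real.add_one_le_exp (z * Real.cosh s / γ)
        have h4 : z * Real.exp s / (2 * γ) ≤ z * Real.cosh s / γ := by
          rw [Real.cosh_eq, div_le_div_iff₀ (by positivity) hγ]
          have := mul_pos (mul_pos hz hγ) (Real.exp_pos (-s))
          nlinarith
        linarith
      have h5 := Real.rpow_le_rpow (by positivity) hw hγ.le
      rw [← Real.exp_mul, div_mul_cancel₀ _ hγ.ne', Real.div_rpow (by positivity) (by positivity),
        Real.mul_rpow hz.le (Real.exp_pos _).le, ← Real.exp_mul,
        div_le_iff₀ (by positivity)] at h5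
      rw [neg_mul, Real.exp_neg, Real.rpow_neg hz.le, neg_mul, Real.exp_neg]
      rw [inv_le_iff_one_le_mul₀ (Real.exp_pos _)]
      have : 0 < z ^ γ := by positivity
      field_simp
      rw [mul_comm γ s]
      linarith
    calc _ ≤ (2 * γ) ^ γ * z ^ (-γ) * Real.exp (-γ * s) * Real.exp (|β| * s) := by gcongr
      _ = _ := by rw [mul_assoc, ← Real.exp_add]; ring_nf
  calc besselK β z ≤ ∫ s in Ioi (0 : ℝ), (2 * γ) ^ γ * z ^ (-γ) * Real.exp (-(γ - |β|) * s) :=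
        setIntegral_mono_on (integrableOn_besselK β hz) (hint.const_mul _) measurableSet_Ioi hb
    _ = (2 * γ) ^ γ * z ^ (-γ) * J := by rw [integral_const_mul]
    _ ≤ _ := by
      have : 0 < (2 * γ) ^ γ * z ^ (-γ) := by positivity
      nlinarith

theorem tendsto_rpow_mul_besselK {α : ℝ} (hα : 0 < α) :
    (∃ l, 0 < l ∧ Tendsto (fun z => z ^ α * besselK α z) (𝓝[>] 0) (𝓝 l)) ∧
      Tendsto (fun z => z * (z ^ α * besselK (α - 1) z)) (𝓝[>] 0) (𝓝 0) := by
  obtain ⟨δ, hδ, hlt⟩ : ∃ δ, 0 < δ ∧ |α - 1| < α + 1 - δ := by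
    have : |α - 1| < α + 1 := abs_lt.2 ⟨by linarith, by linarith⟩
    exact ⟨(α + 1 - |α - 1|) / 2, by linarith, by linarith⟩
  obtain ⟨C, hC, hK⟩ := besselK_le_rpow hlt
  have hb : ∀ z, 0 < z → z ^ α * besselK (α - 1) z ≤ C * z ^ (δ - 1) := fun z hz =>
    (mul_le_mul_of_nonneg_left (hK z hz) (by positivity)).trans_eq <| by
      rw [mul_left_comm, ← Real.rpow_add hz]
      ring_nf
  have hz0 : Tendsto (fun z : ℝ => z ^ δ) (𝓝[>] 0) (𝓝 0) := by
    have := (Real.continuousAt_rpow_const 0 δ (Or.inr hδ.le)).tendsto.mono_left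
      (nhdsWithin_le_nhds (s := Ioi 0))
    rwa [Real.zero_rpow hδ.ne'] at this
  have hpos : ∀ β z : ℝ, 0 < z → 0 < z ^ α * besselK β z := fun β z hz =>
    mul_pos (by positivity) (besselK_pos β hz)
  refine ⟨?_, ?_⟩
  · set q : ℝ → ℝ := fun z => z ^ α * besselK α z
    set f : ℝ → ℝ := fun z => q z + C / δ * z ^ δ
    have hq : ∀ z, 0 < z → HasDerivAt q _ z := fun z hz => hasDerivAt_rpow_mul_besselK α hz
    have hf : ∀ z, 0 < z →
        HasDerivAt f (-(z ^ α * besselK (α - 1) z) + C * z ^ (δ - 1)) z := fun z hz =>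
      ((hq z hz).add ((Real.hasDerivAt_rpow_const (Or.inl hz.ne')).const_mul (C / δ))).congr_deriv
        (by field_simp)
    have hanti : AntitoneOn q (Ioi 0) := by
      refine antitoneOn_of_deriv_nonpos (convex_Ioi 0)
        (fun z hz => (hq z hz).continuousAt.continuousWithinAt) ?_ ?_ <;>
        rw [interior_Ioi] <;> intro z hz
      · exact (hq z hz).differentiableAt.differentiableWithinAt
      · rw [(hq z hz).deriv]
        linarith [hpos (α - 1) z hz]
    have hmono : MonotoneOn f (Ioi 0) := by
      refine monotoneOn_of_deriv_nonneg (convex_Ioi 0)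
        (fun z hz => (hf z hz).continuousAt.continuousWithinAt) ?_ ?_ <;>
        rw [interior_Ioi] <;> intro z hz
      · exact (hf z hz).differentiableAt.differentiableWithinAt
      · rw [(hf z hz).deriv]
        linarith [hb z hz]
    have hbdd : BddBelow (f '' Ioi 0) := ⟨0, by
      rintro _ ⟨z, hz, rfl⟩
      have hz : 0 < z := hz
      have := hpos α z hz
      positivity⟩
    have hlim := hmono.tendsto_nhdsGT hbdd
    have hlim' : Tendsto q (𝓝[>] 0) (𝓝 (sInf (f '' Ioi 0))) := by
      have := hlim.sub (hz0.const_mul (C / δ))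
      simpa [f] using this
    refine ⟨_, lt_of_lt_of_le (hpos α 1 one_pos) (ge_of_tendsto hlim' ?_), hlim'⟩
    filter_upwards [Ioo_mem_nhdsGT (zero_lt_one' ℝ)] with z hz
    exact hanti hz.1 (mem_Ioi.2 one_pos) hz.2.le
  · refine squeeze_zero' ?_ ?_ (by simpa using hz0.const_mul C)
    · filter_upwards [self_mem_nhdsWithin] with z hz
      exact mul_nonneg (le_of_lt hz) (hpos _ z hz).le
    · filter_upwards [self_mem_nhdsWithin] with z hz
      have hz : 0 < z := hz
      calc _ ≤ z * (C * z ^ (δ - 1)) := mul_le_mul_of_nonneg_left (hb z hz) hz.le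
        _ = _ := by
          rw [Real.rpow_sub_one hz.ne']
          field_simp

theorem rpow_mul_tildeK (α : ℝ) {z : ℝ} (hz : 0 < z) :
    z ^ (2 * α) * tildeK α z = 2 ^ α * (z ^ α * besselK α z) := by
  rw [tildeK, Real.div_rpow hz.le zero_le_two, Real.rpow_neg hz.le, Real.rpow_neg zero_le_two,
    two_mul, Real.rpow_add hz]
  have : 0 < z ^ α := by positivity
  have : (0 : ℝ) < 2 ^ α := by positivity
  field_simp

/-- `z^{2α} K̃_α(z)` has a nonzero limit at the origin and its Euler derivative tends to zero. -/
theorem tendsto_rpow_mul_tildeK {α : ℝ} (hα : 0 < α) :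
    (∃ l, l ≠ 0 ∧ Tendsto (fun z => z ^ (2 * α) * tildeK α z) (𝓝[>] 0) (𝓝 l)) ∧
      Tendsto (fun z => z ^ (2 * α) * (2 * α * tildeK α z + -(z ^ 2 / 2) * tildeK (α + 1) z))
        (𝓝[>] 0) (𝓝 0) := by
  obtain ⟨⟨l, hl, h⟩, h'⟩ := tendsto_rpow_mul_besselK hα
  refine ⟨⟨2 ^ α * l, by positivity, (h.const_mul (2 ^ α)).congr' ?_⟩,
    (by simpa using h'.const_mul (-2 ^ α) : Tendsto _ _ (𝓝 (0 : ℝ))).congr' ?_⟩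
  · filter_upwards [self_mem_nhdsWithin] with z hz using (rpow_mul_tildeK α hz).symm
  · filter_upwards [self_mem_nhdsWithin] with z hz
    have hz : 0 < z := hz
    have h1 := rpow_mul_tildeK α hz
    have h2 := rpow_mul_tildeK (α + 1) hz
    rw [show 2 * (α + 1) = 2 * α + 1 + 1 by ring, Real.rpow_add_one hz.ne',
      Real.rpow_add_one hz.ne', Real.rpow_add_one hz.ne', Real.rpow_add_one two_ne_zero,
      besselK_succ α hz] at h2
    rw [mul_add, mul_left_comm _ (2 * α), h1]
    have h3 : z ^ (2 * α) * (-(z ^ 2 / 2) * tildeK (α + 1) z)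
        = -(z ^ (2 * α) * z * z * tildeK (α + 1) z) / 2 := by ring
    rw [h3, h2]
    field_simp
    ring

theorem exists_contDiff_pow_mul_tildeK {m : ℕ} (hm : Odd m) :
    ∃ P : ℝ → ℝ, ContDiff ℝ ∞ P ∧ P 0 ≠ 0 ∧ ∀ z, 0 < z → z ^ m * tildeK ((m : ℝ) / 2) z = P z := by
  obtain ⟨k, rfl⟩ := hm
  obtain ⟨P, hP, h⟩ := exists_contDiff_rpow_mul_besselK k
  set α : ℝ := ((2 * k + 1 : ℕ) : ℝ) / 2 with hα
  have hαk : (k : ℝ) + 1 / 2 = α := by rw [hα]; push_cast; ring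
  have h2 : 2 * α = ((2 * k + 1 : ℕ) : ℝ) := by rw [hα]; ring
  rw [hαk] at h
  have hα0 : 0 < α := by positivity
  obtain ⟨l, hl, hlim⟩ := (tendsto_rpow_mul_tildeK hα0).1
  have hQ : ∀ z, 0 < z → z ^ (2 * k + 1) * tildeK α z = 2 ^ α * P z := fun z hz => by
    rw [← h z hz, ← rpow_mul_tildeK α hz, h2, Real.rpow_natCast]
  refine ⟨fun z => 2 ^ α * P z, contDiff_const.mul hP, ?_, hQ⟩
  have hc : Continuous fun z => 2 ^ α * P z := continuous_const.mul hP.continuous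
  have := tendsto_nhds_unique (hc.continuousWithinAt (s := Ioi 0) (x := 0)).tendsto
    (hlim.congr' (by
      filter_upwards [self_mem_nhdsWithin] with z hz
      rw [← hQ z hz, h2, Real.rpow_natCast]))
  simp only at this ⊢
  rwa [this]

/-! ### Behaviour of Taylor coefficients at the origin -/

/-- `f` is smooth on `(0,∞)` and tends to `l` at `0`, and `θf, …, θⁿf` tend to `0` at `0`. -/
def EulerLimit : ℕ → (ℝ → ℝ) → ℝ → Prop
  | 0, f, l => ContDiffOn ℝ ∞ f (Ioi 0) ∧ Tendsto f (𝓝[>] 0) (𝓝 l)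
  | n + 1, f, l => (ContDiffOn ℝ ∞ f (Ioi 0) ∧ Tendsto f (𝓝[>] 0) (𝓝 l)) ∧
      ∃ f', HasEulerOn (Ioi 0) f f' ∧ EulerLimit n f' 0

namespace EulerLimit

variable {n : ℕ} {f g : ℝ → ℝ} {l r : ℝ}

theorem zero (h : EulerLimit n f l) : EulerLimit 0 f l := by
  cases n with
  | zero => exact h
  | succ n => exact h.1

theorem pred (h : EulerLimit (n + 1) f l) : EulerLimit n f l := by
  induction n generalizing f l with
  | zero => exact h.zero
  | succ n ih =>
    obtain ⟨h0, f', hf', h⟩ := h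
    exact ⟨h0, f', hf', ih h⟩

theorem add (hf : EulerLimit n f l) (hg : EulerLimit n g r) :
    EulerLimit n (fun z => f z + g z) (l + r) := by
  induction n generalizing f g l r with
  | zero => exact ⟨hf.1.add hg.1, hf.2.add hg.2⟩
  | succ n ih =>
    obtain ⟨hf0, f', hf', hf⟩ := hf
    obtain ⟨hg0, g', hg', hg⟩ := hg
    exact ⟨⟨hf0.1.add hg0.1, hf0.2.add hg0.2⟩, _, hf'.add hg', by simpa using ih hf hg⟩

theorem const_mul (c : ℝ) (hf : EulerLimit n f l) : EulerLimit n (fun z => c * f z) (c * l) := by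
  induction n generalizing f l with
  | zero => exact ⟨contDiffOn_const.mul hf.1, hf.2.const_mul c⟩
  | succ n ih =>
    obtain ⟨hf0, f', hf', hf⟩ := hf
    exact ⟨⟨contDiffOn_const.mul hf0.1, hf0.2.const_mul c⟩, _, hf'.const_mul c,
      by simpa using ih hf⟩

theorem id_mul (hf : EulerLimit n f l) : EulerLimit n (fun z => z * f z) 0 := by
  have h0 : EulerLimit 0 (fun z => z * f z) 0 := ⟨contDiffOn_id.mul hf.zero.1, by
    simpa using (tendsto_id.mono_left nhdsWithin_le_nhds).mul hf.zero.2⟩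
  induction n generalizing f l with
  | zero => exact h0
  | succ n ih =>
    have hf1 := hf.pred
    obtain ⟨hf0, f', hf', hf⟩ := hf
    refine ⟨h0, fun z => z * f z + z * f' z, ?_, ?_⟩
    · have := (HasEulerOn.pow (s := Ioi 0) subset_rfl 1).mul hf'
      simpa using this
    · simpa using (ih hf1 h0).add (ih hf ⟨contDiffOn_id.mul hf.zero.1, by
        simpa using (tendsto_id.mono_left nhdsWithin_le_nhds).mul hf.zero.2⟩)

end EulerLimit

theorem BesselPair.eulerLimit {σ l : ℝ} {R R' : ℝ → ℝ} (h : BesselPair σ R R')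
    (hR : EulerLimit 0 R l) (hR' : EulerLimit 0 R' 0) (n : ℕ) :
    EulerLimit n R l ∧ EulerLimit n R' 0 := by
  induction n with
  | zero => exact ⟨hR, hR'⟩
  | succ n ih =>
    refine ⟨⟨hR, R', h.euler, ih.2⟩, hR', _, h.euler', ?_⟩
    simpa [sq, sub_eq_add_neg, mul_assoc] using ih.1.id_mul.id_mul.add (ih.2.const_mul (-σ))

theorem EulerLimit.tendsto_iteratedDeriv {n : ℕ} {f : ℝ → ℝ} {l : ℝ} (hf : EulerLimit n f l)
    {P : ℝ → ℝ} (hP : ContDiff ℝ ∞ P) (c : ℝ) :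
    Tendsto (fun x => iteratedDeriv n
        (fun t => (1 - t) ^ c * P (t * x / (1 - t)) * f (x / (1 - t))) 0)
      (𝓝[>] 0) (𝓝 (l * P 0 * ∏ i ∈ Finset.range n, (i - c))) := by
  induction n generalizing f l P c with
  | zero => simpa [mul_comm] using hf.2.const_mul (P 0)
  | succ n ih =>
    have hf1 := hf.pred
    obtain ⟨hf0, f', hf', hfn⟩ := hf
    have hP' : ContDiff ℝ ∞ (deriv P) := (contDiff_infty_iff_deriv.1 hP).2
    have h1 : EulerLimit n (fun z => -c * f z + f' z) (-c * l) := by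
      simpa using (hf1.const_mul (-c)).add hfn
    have h2 := hf1.id_mul
    have hsm : ∀ {x : ℝ} {g Q : ℝ → ℝ}, 0 < x → ContDiffOn ℝ ∞ g (Ioi 0) → ContDiff ℝ ∞ Q →
        ContDiffAt ℝ n
          (fun t => (1 - t) ^ (c - 1) * Q (t * x / (1 - t)) * g (x / (1 - t))) 0 := by
      intro x g Q hx hg hQ
      refine ContDiffAt.of_le (n := ∞) ?_ (WithTop.coe_le_coe.2 le_top)
      have hs : ContDiffAt ℝ ∞ (fun t : ℝ => 1 - t) 0 := by fun_prop
      have h0 : (1 - 0 : ℝ) ≠ 0 := by norm_num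
      refine ((hs.rpow_const_of_ne h0).mul (hQ.contDiffAt.comp 0
        ((contDiffAt_id.mul contDiffAt_const).div hs h0))).mul
        (ContDiffAt.comp 0 (hg.contDiffAt (isOpen_Ioi.mem_nhds ?_))
          (contDiffAt_const.div hs h0))
      simpa using hx
    have key := (ih h1 hP (c - 1)).add (ih h2 hP' (c - 1))
    have e : -c * l * P 0 * ∏ i ∈ Finset.range n, ((i : ℝ) - (c - 1))
        + 0 * deriv P 0 * ∏ i ∈ Finset.range n, ((i : ℝ) - (c - 1))
        = l * P 0 * ∏ i ∈ Finset.range (n + 1), ((i : ℝ) - c) := by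
      rw [Finset.prod_range_succ']
      push_cast
      simp only [← sub_add, sub_add_eq_add_sub]
      ring
    rw [e] at key
    refine key.congr' ?_
    filter_upwards [self_mem_nhdsWithin] with x hx
    have hx : 0 < x := hx
    rw [← iteratedDeriv_fun_add (hsm hx h1.zero.1 hP) (hsm hx h2.zero.1 hP'), iteratedDeriv_succ']
    refine Filter.EventuallyEq.iteratedDeriv_eq n ?_
    filter_upwards [isOpen_Iio.mem_nhds (show (0 : ℝ) ∈ Iio 1 by simp)] with t ht
    have ht1 : 0 < 1 - t := sub_pos.2 ht
    have d1 := ((hasDerivAt_id t).const_sub 1).rpow_const (p := c) (Or.inl ht1.ne')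
    have d2 := ((hP.differentiable (by simp) (t * x / (1 - t))).hasDerivAt).comp t
      (((hasDerivAt_id t).mul_const x).div ((hasDerivAt_id t).const_sub 1) ht1.ne')
    have d3 := (hf' (x / (1 - t)) (div_pos hx ht1)).comp t
      ((hasDerivAt_const t x).div ((hasDerivAt_id t).const_sub 1) ht1.ne')
    refine ((d1.mul d2).mul d3).deriv.symm ▸ ?_
    simp only [Function.comp, id, Pi.mul_apply, Pi.div_apply]
    rw [Real.rpow_sub_one ht1.ne']
    field_simp
    ring

theorem tendsto_rpow_mul_iteratedDeriv_besselProduct {n k : ℕ} {a ρ l : ℝ} {P B R : ℝ → ℝ}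
    (hP : ContDiff ℝ ∞ P) (hR : EulerLimit n R l) (hB : ∀ w, 0 < w → w ^ ρ * B w = R w) :
    Tendsto (fun x => x ^ (k + ρ) * iteratedDeriv n (fun t => besselProduct a k P B (t, x)) 0)
      (𝓝[>] 0) (𝓝 (l * P 0 * ∏ i ∈ Finset.range n, (i - (a + k + ρ)))) := by
  refine (hR.tendsto_iteratedDeriv hP (a + k + ρ)).congr' ?_
  filter_upwards [self_mem_nhdsWithin] with x hx
  have hx : 0 < x := hx
  rw [← iteratedDeriv_const_mul_field]
  refine Filter.EventuallyEq.iteratedDeriv_eq n ?_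
  filter_upwards [isOpen_Iio.mem_nhds (show (0 : ℝ) ∈ Iio 1 by simp)] with t ht
  have ht1 : 0 < 1 - t := sub_pos.2 ht
  rw [besselProduct, ← hB _ (div_pos hx ht1), Real.div_rpow hx.le ht1.le, Real.rpow_add ht1,
    Real.rpow_add ht1, Real.rpow_natCast, Real.rpow_add hx, Real.rpow_natCast, div_pow]
  have : 0 < (1 - t) ^ ρ := by positivity
  field_simp

/-! ### Linear independence -/

theorem eq_zero_of_tendsto_rpow_mul {ι : Type*} [DecidableEq ι] {f : ι → ℝ → ℝ} {e L : ι → ℝ}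
    {c : ι → ℝ} (s : Finset ι) (he : Set.InjOn e s) (hL : ∀ i ∈ s, L i ≠ 0)
    (hlim : ∀ i ∈ s, Tendsto (fun x => x ^ e i * f i x) (𝓝[>] 0) (𝓝 (L i)))
    (hsum : ∀ x, 0 < x → ∑ i ∈ s, c i * f i x = 0) : ∀ i ∈ s, c i = 0 := by
  induction s using Finset.induction_on_max_value e with
  | empty => simp
  | insert a s ha hmax ih =>
    have hlt : ∀ i ∈ s, e i < e a := fun i hi => (hmax i hi).lt_of_ne fun h =>
      ha (he (Finset.mem_insert_of_mem hi) (Finset.mem_insert_self a s) h ▸ hi)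
    have h1 : ∀ i ∈ s, Tendsto (fun x => c i * (x ^ e a * f i x)) (𝓝[>] 0) (𝓝 0) := by
      intro i hi
      have h2 : Tendsto (fun x : ℝ => x ^ (e a - e i)) (𝓝[>] 0) (𝓝 0) := by
        have h3 := sub_pos.2 (hlt i hi)
        have := (Real.continuousAt_rpow_const 0 (e a - e i) (Or.inr h3.le)).tendsto.mono_left
          (nhdsWithin_le_nhds (s := Ioi 0))
        rwa [Real.zero_rpow h3.ne'] at this
      have h4 := (h2.mul (hlim i (Finset.mem_insert_of_mem hi))).const_mul (c i)
      simp only [zero_mul, mul_zero] at h4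
      refine h4.congr' ?_
      filter_upwards [self_mem_nhdsWithin] with x hx
      rw [← mul_assoc (x ^ _) (x ^ _), ← Real.rpow_add hx, sub_add_cancel]
    have h2 := ((hlim a (Finset.mem_insert_self a s)).const_mul (c a)).add (tendsto_finsetSum s h1)
    have h3 : Tendsto (fun _ : ℝ => (0 : ℝ)) (𝓝[>] 0)
        (𝓝 (c a * L a + ∑ i ∈ s, 0)) := h2.congr' <| by
      filter_upwards [self_mem_nhdsWithin] with x hx
      have := hsum x hx
      rw [Finset.sum_insert ha] at this
      calc _ = x ^ e a * (c a * f a x + ∑ i ∈ s, c i * f i x) := by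
            rw [mul_add, Finset.mul_sum]
            congr 1
            · ring
            · exact Finset.sum_congr rfl fun i _ => by ring
        _ = 0 := by rw [this, mul_zero]
    have hca : c a = 0 := by
      have := tendsto_nhds_unique h3 tendsto_const_nhds
      simpa [hL a (Finset.mem_insert_self a s)] using this
    intro i hi
    rcases Finset.mem_insert.1 hi with rfl | hi
    · exact hca
    · refine ih (he.mono (by simp)) (fun i hi => hL i (Finset.mem_insert_of_mem hi))
        (fun i hi => hlim i (Finset.mem_insert_of_mem hi)) (fun x hx => ?_) i hi
      simpa [Finset.sum_insert ha, hca] using hsum x hx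

/-! ### The four families of solutions -/

theorem exists_eulerLimit_tildeI {α : ℝ} (hα : 0 ≤ α) :
    ∃ l, l ≠ 0 ∧ ∀ n, EulerLimit n (tildeI α) l := by
  have hI := contDiff_tildeI hα
  have hI' : ContDiff ℝ ∞ fun z => z ^ 2 / 2 * tildeI (α + 1) z :=
    (contDiff_id.pow 2 |>.div_const 2).mul (contDiff_tildeI (by positivity))
  refine ⟨_, (tildeI_zero_pos hα).ne', fun n =>
    ((besselPair_tildeI hα).eulerLimit ⟨hI.contDiffOn, ?_⟩ ⟨hI'.contDiffOn, ?_⟩ n).1⟩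
  · exact hI.continuous.continuousWithinAt
  · have := (hI'.continuous.continuousWithinAt (s := Ioi 0) (x := 0)).tendsto
    simpa using this

theorem exists_eulerLimit_tildeK {α : ℝ} (hα : 0 < α) :
    ∃ l, l ≠ 0 ∧ ∀ n, EulerLimit n (fun z => z ^ (2 * α) * tildeK α z) l := by
  obtain ⟨⟨l, hl, h⟩, h'⟩ := tendsto_rpow_mul_tildeK hα
  have hp : ContDiffOn ℝ ∞ (fun z : ℝ => z ^ (2 * α)) (Ioi 0) :=
    contDiffOn_id.rpow_const_of_ne fun z hz => ne_of_gt hz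
  have hK := contDiffOn_tildeK α
  have hK' := contDiffOn_tildeK (α + 1)
  refine ⟨l, hl, fun n => ((besselPair_tildeK α).rpow_mul.eulerLimit ⟨hp.mul hK, h⟩
    ⟨hp.mul ((contDiffOn_const.mul hK).add (ContDiffOn.mul ?_ hK')), h'⟩ n).1⟩
  fun_prop

theorem Dop_and_tendsto_of_eq_besselProduct {μ ν ρ N l : ℝ} {j k : ℕ} {A A' B B' P R u : ℝ → ℝ}
    (hA : BesselPair μ A A') (hB : BesselPair ν B B')
    (hP : ∀ z, 0 < z → z ^ k * A z = P z) (hPs : ContDiff ℝ ∞ P) (hP0 : P 0 ≠ 0)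
    (hBs : ContDiffOn ℝ ∞ B (Ioi 0)) (hl : l ≠ 0) (hR : ∀ n, EulerLimit n R l)
    (hBR : ∀ w, 0 < w → w ^ ρ * B w = R w) (hN : N ≠ 0)
    (hne : ∀ i : ℕ, (i : ℝ) ≠ -(μ + ν + 2) / 2 + k + ρ)
    (hu : ∀ x, 0 < x → u x = iteratedDeriv (j + k)
      (fun t => besselProduct (-(μ + ν + 2) / 2) k P B (t, x)) 0 / N) :
    (∀ x, 0 < x → Dop μ ν u x = 4 * (j : ℝ) * ((j : ℝ) + μ + 1) * u x) ∧
      ∃ L, L ≠ 0 ∧ Tendsto (fun x => x ^ (k + ρ) * u x) (𝓝[>] 0) (𝓝 L) := by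
  refine ⟨fun x hx => ?_, l * P 0 * (∏ i ∈ Finset.range (j + k),
    (i - (-(μ + ν + 2) / 2 + k + ρ))) / N, ?_, ?_⟩
  · have h : EqOn u (fun x => N⁻¹ * iteratedDeriv (j + k)
        (fun t => besselProduct (-(μ + ν + 2) / 2) k P B (t, x)) 0) (Ioi 0) := fun y hy => by
      rw [hu y hy, div_eq_inv_mul]
    rw [Dop_congr μ ν h hx, Dop_const_mul, Dop_iteratedDeriv_besselProduct hA hB hP hPs hBs _ hx,
      h hx]
    push_cast
    ring
  · exact div_ne_zero (mul_ne_zero (mul_ne_zero hl hP0)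
      (Finset.prod_ne_zero_iff.2 fun i _ => sub_ne_zero.2 (hne i))) hN
  · refine ((tendsto_rpow_mul_iteratedDeriv_besselProduct hPs (hR (j + k)) hBR).div_const
      N).congr' ?_
    filter_upwards [self_mem_nhdsWithin] with x hx
    rw [hu x hx, mul_div_assoc]

/-- For `μ` a positive odd integer and real `ν > 0` with `μ − ν ∉ 2ℤ`, and each `j ∈ ℕ₀`,
the four functions `Λ_{i,j}^{μ,ν}` (`i = 1,2,3,4`) each solve the fourth order equation
`D_{μ,ν}u = 4j(j+μ+1)u` on `(0,∞)` and are linearly independent there; hence they form a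
fundamental system of solutions of this equation. -/
theorem statement6 (m : ℕ) (hm : Odd m) (hm0 : 0 < m) (ν : ℝ) (hν : 0 < ν)
    (hpar : ¬ ∃ k : ℤ, (m : ℝ) - ν = 2 * (k : ℝ)) (j : ℕ) :
    (∀ x : ℝ, 0 < x →
      Dop (m : ℝ) ν (fun y => Lambda₁ (m : ℝ) ν j y) x
        = 4 * (j : ℝ) * ((j : ℝ) + (m : ℝ) + 1) * Lambda₁ (m : ℝ) ν j x ∧
      Dop (m : ℝ) ν (fun y => Lambda₂ (m : ℝ) ν j y) x
        = 4 * (j : ℝ) * ((j : ℝ) + (m : ℝ) + 1) * Lambda₂ (m : ℝ) ν j x ∧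
      Dop (m : ℝ) ν (fun y => Lambda₃ m ν (j : ℤ) y) x
        = 4 * (j : ℝ) * ((j : ℝ) + (m : ℝ) + 1) * Lambda₃ m ν (j : ℤ) x ∧
      Dop (m : ℝ) ν (fun y => Lambda₄ m ν (j : ℤ) y) x
        = 4 * (j : ℝ) * ((j : ℝ) + (m : ℝ) + 1) * Lambda₄ m ν (j : ℤ) x) ∧
    (∀ c₁ c₂ c₃ c₄ : ℝ,
      (∀ x : ℝ, 0 < x →
        c₁ * Lambda₁ (m : ℝ) ν j x + c₂ * Lambda₂ (m : ℝ) ν j x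
          + c₃ * Lambda₃ m ν (j : ℤ) x + c₄ * Lambda₄ m ν (j : ℤ) x = 0) →
      c₁ = 0 ∧ c₂ = 0 ∧ c₃ = 0 ∧ c₄ = 0) := by
  have hm' : (0 : ℝ) < m := by exact_mod_cast hm0
  have hα : (0 : ℝ) ≤ (m : ℝ) / 2 := by positivity
  have hβ : 0 < ν / 2 := by positivity
  have hm2 : 2 * ((m : ℝ) / 2) = m := mul_div_cancel₀ _ two_ne_zero
  have hν2 : 2 * (ν / 2) = ν := mul_div_cancel₀ _ two_ne_zero
  have hA₁ := besselPair_tildeI hα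
  have hA₂ := besselPair_tildeK ((m : ℝ) / 2)
  have hB₁ := besselPair_tildeI hβ.le
  have hB₂ := besselPair_tildeK (ν / 2)
  rw [hm2] at hA₁ hA₂
  rw [hν2] at hB₁ hB₂
  have hI := contDiff_tildeI hα
  have hI0 := (tildeI_zero_pos hα).ne'
  have hBI := (contDiff_tildeI hβ.le).contDiffOn (s := Ioi 0)
  have hBK := contDiffOn_tildeK (ν / 2)
  obtain ⟨P, hP, hP0, hPK⟩ := exists_contDiff_pow_mul_tildeK hm
  obtain ⟨l₁, hl₁, hR₁⟩ := exists_eulerLimit_tildeI hβ.le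
  obtain ⟨l₂, hl₂, hR₂⟩ := exists_eulerLimit_tildeK hβ
  rw [hν2] at hR₂
  have hfac : ∀ n : ℕ, (n.factorial : ℝ) ≠ 0 := fun n => by exact_mod_cast n.factorial_ne_zero
  have hj : -(m : ℤ) ≤ j := by omega
  have hjm : ((j : ℤ) + m).toNat = j + m := by omega
  obtain ⟨hD₁, L₁, hL₁, hlim₁⟩ := Dop_and_tendsto_of_eq_besselProduct (ρ := 0) (j := j) (k := 0)
    (u := Lambda₁ m ν j) hA₁ hB₁ (fun z _ => by simp) hI hI0 hBI hl₁ hR₁ (fun w _ => by simp)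
    (hfac j) (fun i h => by
      have : (0 : ℝ) ≤ i := i.cast_nonneg
      push_cast at h
      linarith)
    (fun x _ => by simp [Lambda₁, genG₁, besselProduct])
  obtain ⟨hD₂, L₂, hL₂, hlim₂⟩ := Dop_and_tendsto_of_eq_besselProduct (ρ := ν) (j := j) (k := 0)
    (u := Lambda₂ m ν j) hA₁ hB₂ (fun z _ => by simp) hI hI0 hBK hl₂ hR₂ (fun w _ => rfl)
    (hfac j) (fun i h => hpar ⟨-(i + 1), by
      push_cast at h ⊢
      linarith⟩)
    (fun x _ => by simp [Lambda₂, genG₂, besselProduct])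
  obtain ⟨hD₃, L₃, hL₃, hlim₃⟩ := Dop_and_tendsto_of_eq_besselProduct (ρ := 0) (j := j) (k := m)
    (u := Lambda₃ m ν j) hA₂ hB₁ hPK hP hP0 hBI hl₁ hR₁ (fun w _ => by simp)
    (hfac (j + m)) (fun i h => hpar ⟨i + 1, by
      push_cast at h ⊢
      linarith⟩)
    (fun x hx => by
      rw [Lambda₃, if_pos hj, hjm, ← limUnder_iteratedDeriv_besselProduct _ hPK hP hBI _ hx]
      rfl)
  obtain ⟨hD₄, L₄, hL₄, hlim₄⟩ := Dop_and_tendsto_of_eq_besselProduct (ρ := ν) (j := j) (k := m)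
    (u := Lambda₄ m ν j) hA₂ hB₂ hPK hP hP0 hBK hl₂ hR₂ (fun w _ => rfl)
    (hfac (j + m)) (fun i h => hpar ⟨m - i - 1, by
      push_cast at h ⊢
      linarith⟩)
    (fun x hx => by
      rw [Lambda₄, if_pos hj, hjm, ← limUnder_iteratedDeriv_besselProduct _ hPK hP hBK _ hx]
      rfl)
  refine ⟨fun x hx => ⟨hD₁ x hx, hD₂ x hx, hD₃ x hx, hD₄ x hx⟩, fun c₁ c₂ c₃ c₄ h => ?_⟩
  have hmν : (m : ℝ) ≠ ν := fun h => hpar ⟨0, by simp [h]⟩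
  have hinj : Function.Injective ![0 + 0, 0 + ν, (m : ℝ) + 0, (m : ℝ) + ν] := by
    have h1 := hν.ne'
    have h2 := hm'.ne'
    have h3 := (add_pos hm' hν).ne'
    intro a b
    fin_cases a <;> fin_cases b <;>
      simp [h1, h2, h3, h1.symm, h2.symm, h3.symm, hmν, hmν.symm]
  have key := eq_zero_of_tendsto_rpow_mul
    (f := ![Lambda₁ m ν j, Lambda₂ m ν j, Lambda₃ m ν j, Lambda₄ m ν j])
    (L := ![L₁, L₂, L₃, L₄]) (c := ![c₁, c₂, c₃, c₄]) Finset.univ hinj.injOn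
    (fun i _ => by fin_cases i <;> assumption)
    (fun i _ => by
      rw [Nat.cast_zero] at hlim₁ hlim₂
      fin_cases i <;> assumption)
    (fun x hx => by simpa [Fin.sum_univ_four] using h x hx)
  exact ⟨key 0 (Finset.mem_univ _), key 1 (Finset.mem_univ _), key 2 (Finset.mem_univ _),
    key 3 (Finset.mem_univ _)⟩
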